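/- arXiv:0804.3134 — 2 statements merged into one kernel-verified Lean document; each statement's English description precedes it below -/
import Mathlib

section
/- For every integer g ≥ 3, every odd integer N ≥ 1, and i ∈ {1, 2}, the group cohomology Hⁱ(Sp_{2g}(ℤ/Nℤ), ℂ*) vanishes, where ℂ* is the multiplicative group of nonzero complex numbers with trivial Sp_{2g}(ℤ/Nℤ)-action. -/
open Matrix

/-- The paper's standard symplectic form matrix `J = [[0, 1_g], [-1_g, 0]]`. -/
def paperJ (l R : Type*) [DecidableEq l] [CommRing R] : Matrix (l ⊕ l) (l ⊕ l) R :=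
  Matrix.fromBlocks 0 1 (-1) 0

/-- The paper's symplectic condition `ᵀM·J·M = J` (with `J = [[0, 1_g], [-1_g, 0]]`)
characterizes membership in Mathlib's `Matrix.symplecticGroup`; hence the latter *is* the
symplectic group `Sp_{2g}(R)` of the paper. -/
theorem mem_symplecticGroup_iff_paper {l R : Type*} [DecidableEq l] [Fintype l] [CommRing R]
    (M : Matrix (l ⊕ l) (l ⊕ l) R) :
    M ∈ Matrix.symplecticGroup l R ↔ Mᵀ * paperJ l R * M = paperJ l R := by
  have hJ : paperJ l R = -(Matrix.J l R) := by
    rw [paperJ, Matrix.J, Matrix.fromBlocks_neg]; norm_num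
  rw [SymplecticGroup.mem_iff', hJ]
  constructor
  · intro h; rw [Matrix.mul_neg, Matrix.neg_mul, h]
  · intro h
    have := congrArg Neg.neg h
    simpa [Matrix.mul_neg, Matrix.neg_mul] using this

/-- The properties of `ℤ/pᵏ` (`p` an odd prime) that are used below. -/
class IsOddResidueRing (R : Type*) [CommRing R] : Prop extends IsLocalRing R where
  isUnit_two : IsUnit (2 : R)
  exists_intCast_eq (r : R) : ∃ n : ℤ, (n : R) = r
  isCyclic_units : IsCyclic Rˣ
  dvd_total (a b : R) : a ∣ b ∨ b ∣ a
  exists_nonsquare : ∃ u v : Rˣ, ¬ IsSquare u ∧ ¬ IsSquare v ∧ (u : R) + v = 1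

namespace Symp

section Ring

variable {R : Type*} [CommRing R] [IsLocalRing R]

theorem isUnit_add_of_not {a b : R} (ha : IsUnit a) (hb : ¬ IsUnit b) : IsUnit (a + b) := by
  by_contra h
  have h1 := IsLocalRing.nonunits_add (a := a + b) (b := -b) h (by simpa using hb)
  simp at h1
  exact h1 ha

theorem isUnit_sub_of_not {a b : R} (ha : IsUnit a) (hb : ¬ IsUnit b) : IsUnit (a - b) := by
  rw [sub_eq_add_neg]
  exact isUnit_add_of_not ha (by simpa using hb)

theorem isUnit_add_of_not_left {a b : R} (ha : ¬ IsUnit a) (hb : IsUnit b) : IsUnit (a + b) := by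
  rw [add_comm]
  exact isUnit_add_of_not hb ha

theorem isUnit_sub_of_not_left {a b : R} (ha : ¬ IsUnit a) (hb : IsUnit b) : IsUnit (a - b) := by
  have := (isUnit_sub_of_not hb ha).neg
  simpa using this

theorem isUnit_add_or_isUnit_sub (h2 : IsUnit (2 : R)) {a : R} (ha : IsUnit a) (b : R) :
    IsUnit (a + b) ∨ IsUnit (a - b) := by
  by_contra! h
  have h1 := IsLocalRing.nonunits_add (a := a + b) (b := a - b) h.1 h.2
  have : a + b + (a - b) = 2 * a := by ring
  rw [this] at h1
  exact h1 (h2.mul ha)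

end Ring

variable {R V : Type*} [CommRing R] [AddCommGroup V] [Module R V]

/-- The isometry group of a bilinear form. -/
def Sp (ω : V →ₗ[R] V →ₗ[R] R) : Subgroup (V ≃ₗ[R] V) where
  carrier := {M | ∀ x y, ω (M x) (M y) = ω x y}
  mul_mem' := by
    intro a b ha hb x y
    simp [LinearEquiv.mul_apply, ha _ _, hb _ _]
  one_mem' := by intro x y; rfl
  inv_mem' := by
    intro a ha x y
    have := ha (a⁻¹ x) (a⁻¹ y)
    rw [← this]
    simp

variable {ω : V →ₗ[R] V →ₗ[R] R}

theorem form_smul_smul (M : Sp ω) (x y : V) : ω (M • x) (M • y) = ω x y := M.2 x y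

theorem form_smul_left (M : Sp ω) (x y : V) : ω (M • x) y = ω x (M⁻¹ • y) := by
  rw [← form_smul_smul M x, smul_inv_smul]

theorem form_smul_right (M : Sp ω) (x y : V) : ω x (M • y) = ω (M⁻¹ • x) y := by
  rw [← form_smul_smul M _ y, smul_inv_smul]

theorem Sp.ext {M M' : Sp ω} (h : ∀ x : V, M • x = M' • x) : M = M' :=
  Subtype.ext (LinearEquiv.ext h)

theorem Sp.smul_smul_comm (M : Sp ω) (c : R) (x : V) : M • (c • x) = c • (M • x) :=
  map_smul (M : V ≃ₗ[R] V) c x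

variable [hω : Fact ω.IsAlt]

@[simp] theorem form_self (x : V) : ω x x = 0 := hω.out x

theorem form_swap (x y : V) : ω x y = - ω y x := (hω.out.neg y x).symm

theorem form_eq_zero_comm {x y : V} : ω x y = 0 ↔ ω y x = 0 := by
  rw [form_swap x y, neg_eq_zero]

variable (ω) in
/-- The linear map `x ↦ x + ω(v,x) w + ω(w,x) v + a ω(v,x) v`. -/
def heisLin (v w : V) (a : R) : V →ₗ[R] V :=
  LinearMap.id + (ω v).smulRight w + (ω w).smulRight v + (a • ω v).smulRight v

theorem heisLin_apply (v w : V) (a : R) (x : V) :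
    heisLin ω v w a x = x + ω v x • w + ω w x • v + (a * ω v x) • v := by
  simp [heisLin]

theorem heisLin_heisLin {v w w' : V} (hw : ω v w = 0) (hw' : ω v w' = 0) (a b : R) (x : V) :
    heisLin ω v w a (heisLin ω v w' b x) = heisLin ω v (w + w') (a + b + ω w w') x := by
  have := (form_eq_zero_comm (ω := ω)).1 hw
  simp only [heisLin_apply, map_add, map_smul, hw', hw, this, form_self, smul_eq_mul,
    LinearMap.add_apply]
  module

open Classical in
variable (ω) in
/-- The element `x ↦ x + ω(v,x) w + ω(w,x) v + a ω(v,x) v` of the symplectic group, for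
`w` orthogonal to `v` (by convention it is `1` for other `w`). -/
noncomputable def heis (v w : V) (a : R) : Sp ω :=
  if h : ω v w = 0 then
    ⟨LinearEquiv.ofLinearMap (heisLin ω v w a) (heisLin ω v (-w) (-a))
      (by ext x; simp [heisLin_heisLin, h]; simp [heisLin_apply])
      (by ext x; simp [heisLin_heisLin, h]; simp [heisLin_apply]), by
        intro x y
        have h' := (form_eq_zero_comm (ω := ω)).1 h
        have h1 := form_swap (ω := ω) x w
        have h2 := form_swap (ω := ω) x v
        simp only [LinearEquiv.coe_ofLinearMap, heisLin_apply, map_add, map_smul, smul_eq_mul,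
          LinearMap.add_apply, LinearMap.smul_apply, h, h', form_self, h1, h2]
        ring⟩
  else 1

theorem heis_smul {v w : V} (h : ω v w = 0) (a : R) (x : V) :
    heis ω v w a • x = x + ω v x • w + ω w x • v + (a * ω v x) • v := by
  rw [heis, dif_pos h, ← heisLin_apply]
  rfl

theorem heis_smul_self {v w : V} (h : ω v w = 0) (a : R) : heis ω v w a • v = v := by
  simp [heis_smul h, form_eq_zero_comm.1 h]

theorem heis_mul {v w w' : V} (hw : ω v w = 0) (hw' : ω v w' = 0) (a b : R) :
    heis ω v w a * heis ω v w' b = heis ω v (w + w') (a + b + ω w w') := by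
  apply Sp.ext
  intro x
  have h : ω v (w + w') = 0 := by rw [map_add, hw, hw', add_zero]
  rw [mul_smul, heis_smul hw', heis_smul hw, heis_smul h, ← heisLin_apply, ← heisLin_apply,
    heisLin_heisLin hw hw', heisLin_apply]

theorem heis_zero (v : V) : heis ω v 0 0 = 1 := by
  apply Sp.ext
  intro x
  simp [heis_smul]

theorem heis_conj (M : Sp ω) (v w : V) (a : R) :
    M * heis ω v w a * M⁻¹ = heis ω (M • v) (M • w) a := by
  by_cases h : ω v w = 0
  · apply Sp.ext
    intro x
    have h' : ω (M • v) (M • w) = 0 := by rwa [form_smul_smul]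
    rw [mul_smul, mul_smul, heis_smul h, heis_smul h']
    simp only [smul_add, Sp.smul_smul_comm, form_smul_left, smul_inv_smul]
  · have h' : ¬ ω (M • v) (M • w) = 0 := by rwa [form_smul_smul]
    rw [heis, heis, dif_neg h, dif_neg h']
    simp

theorem heis_scale (c : Rˣ) (v w : V) (a : R) :
    heis ω ((c : R) • v) w a = heis ω v ((c : R) • w) (c ^ 2 * a) := by
  by_cases h : ω v w = 0
  · apply Sp.ext
    intro x
    rw [heis_smul (by simp [h]), heis_smul (by simp [h])]
    simp only [map_smul, LinearMap.smul_apply, smul_eq_mul]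
    module
  · rw [heis, heis, dif_neg, dif_neg] <;> simpa using h

variable (ω) in
/-- The transvection `x ↦ x + a ω(v,x) v`. -/
noncomputable abbrev transv (v : V) (a : R) : Sp ω := heis ω v 0 a

theorem transv_smul (v : V) (a : R) (x : V) : transv ω v a • x = x + (a * ω v x) • v := by
  simp [heis_smul]

variable (ω) in
/-- Vectors having a partner on which the form takes the value `1`. -/
def Uni (v : V) : Prop := ∃ y, ω v y = 1

theorem Uni.smul {v : V} (h : Uni ω v) (M : Sp ω) : Uni ω (M • v) := by
  obtain ⟨y, hy⟩ := h
  exact ⟨M • y, by rw [form_smul_smul, hy]⟩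

omit hω in
theorem uni_of_isUnit {v y : V} (h : IsUnit (ω v y)) : Uni ω v := by
  obtain ⟨u, hu⟩ := h
  exact ⟨(↑u⁻¹ : R) • y, by simp [← hu]⟩

theorem Uni.unit_smul {v : V} (h : Uni ω v) (c : Rˣ) : Uni ω ((c : R) • v) := by
  obtain ⟨y, hy⟩ := h
  exact ⟨(↑c⁻¹ : R) • y, by simp [hy]⟩

theorem Uni.neg {v : V} (h : Uni ω v) : Uni ω (-v) := by
  simpa using h.unit_smul (-1)

variable (ω) in
/-- Two vectors on which the form takes a unit value. -/
def Adj (u v : V) : Prop := IsUnit (ω u v)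

theorem Adj.symm {u v : V} (h : Adj ω u v) : Adj ω v u := by
  rw [Adj, form_swap]
  exact IsUnit.neg h

theorem Adj.uni_left {u v : V} (h : Adj ω u v) : Uni ω u := uni_of_isUnit h

theorem Adj.smul {u v : V} (h : Adj ω u v) (M : Sp ω) : Adj ω (M • u) (M • v) := by
  rwa [Adj, form_smul_smul]

theorem adj_smul_iff {u v : V} (M : Sp ω) : Adj ω (M • u) (M • v) ↔ Adj ω u v := by
  rw [Adj, form_smul_smul, Adj]

/-- If `u` and `v` are adjacent, then `v - u` is unimodular. -/
theorem Adj.uni_sub {u v : V} (h : Adj ω u v) : Uni ω (v - u) := by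
  apply uni_of_isUnit (y := v)
  have : ω (v - u) v = - ω u v := by simp
  rw [this]
  exact IsUnit.neg h

/-- The edge transvection moves `u` to `v`. -/
theorem transv_sub_smul {u v : V} (h : Adj ω u v) :
    transv ω (v - u) (-Ring.inverse (ω u v)) • u = v := by
  rw [transv_smul]
  have h1 : -Ring.inverse (ω u v) * ω (v - u) u = 1 := by
    rw [map_sub, LinearMap.sub_apply, form_self, form_swap v u]
    have := Ring.inverse_mul_cancel _ h
    linear_combination this
  rw [h1]
  module

/-- A submodule in which every unimodular vector has a partner. -/
def HasPartners (ω : V →ₗ[R] V →ₗ[R] R) (U : Submodule R V) : Prop :=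
  ∀ v ∈ U, Uni ω v → ∃ y ∈ U, ω v y = 1

theorem hasPartners_top : HasPartners ω ⊤ := fun v _ ⟨y, hy⟩ => ⟨y, trivial, hy⟩

section Local

variable [IsLocalRing R] {U : Submodule R V} (hU : HasPartners ω U)
include hU

theorem exists_adj₂ {a b : V} (ha : a ∈ U) (hb : b ∈ U) (ua : Uni ω a) (ub : Uni ω b) :
    ∃ x ∈ U, Adj ω a x ∧ Adj ω b x := by
  obtain ⟨y, hy, hay⟩ := hU a ha ua
  obtain ⟨z, hz, hbz⟩ := hU b hb ub
  have hay' : IsUnit (ω a y) := by simp [hay]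
  have hbz' : IsUnit (ω b z) := by simp [hbz]
  by_cases h1 : IsUnit (ω b y)
  · exact ⟨y, hy, hay', h1⟩
  by_cases h2 : IsUnit (ω a z)
  · exact ⟨z, hz, h2, hbz'⟩
  refine ⟨y + z, U.add_mem hy hz, ?_, ?_⟩
  · rw [Adj, map_add]
    exact isUnit_add_of_not hay' h2
  · rw [Adj, map_add]
    exact isUnit_add_of_not_left h1 hbz'

theorem exists_adj₃ (two : IsUnit (2 : R)) {a b c : V} (ha : a ∈ U) (hb : b ∈ U) (hc : c ∈ U)
    (ua : Uni ω a) (ub : Uni ω b) (uc : Uni ω c) :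
    ∃ x ∈ U, Adj ω a x ∧ Adj ω b x ∧ Adj ω c x := by
  obtain ⟨x, hx, hax, hbx⟩ := exists_adj₂ hU ha hb ua ub
  obtain ⟨y, hy, hcy⟩ := hU c hc uc
  have hcy' : IsUnit (ω c y) := by simp [hcy]
  by_cases h1 : IsUnit (ω c x)
  · exact ⟨x, hx, hax, hbx, h1⟩
  by_cases h2 : IsUnit (ω a (x + y)) ∧ IsUnit (ω b (x + y))
  · refine ⟨x + y, U.add_mem hx hy, h2.1, h2.2, ?_⟩
    rw [Adj, map_add]
    exact isUnit_add_of_not_left h1 hcy'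
  by_cases h3 : IsUnit (ω a (x - y)) ∧ IsUnit (ω b (x - y))
  · refine ⟨x - y, U.sub_mem hx hy, h3.1, h3.2, ?_⟩
    rw [Adj, map_sub]
    exact isUnit_sub_of_not_left h1 hcy'
  have key : ∀ d : V, IsUnit (ω d x) → ¬ IsUnit (ω d (x + y)) ∨ ¬ IsUnit (ω d (x - y)) →
      IsUnit (ω d y) := by
    intro d hd h
    by_contra hn
    rcases h with h | h <;> apply h
    · rw [map_add]
      exact isUnit_add_of_not hd hn
    · rw [map_sub]
      exact isUnit_sub_of_not hd hn
  have ka := isUnit_add_or_isUnit_sub two hax (ω a y)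
  have kb := isUnit_add_or_isUnit_sub two hbx (ω b y)
  rw [← map_add, ← map_sub] at ka kb
  refine ⟨y, hy, key a hax ?_, key b hbx ?_, hcy'⟩ <;> tauto

end Local

end Symp

namespace Symp

variable {R V : Type*} [CommRing R] [AddCommGroup V] [Module R V]
variable {ω : V →ₗ[R] V →ₗ[R] R} [hω : Fact ω.IsAlt]
variable {E : Type*} [Group E] {π : E →* Sp ω}

/-- A system of lifts of the elements `heis ω v w a` to a group `E` over the symplectic group,
multiplicative for fixed `v`, equivariant under conjugation and compatible with scaling. -/
structure HeisLift (π : E →* Sp ω) where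
  /-- The lift of `heis ω v w a`. -/
  q : V → V → R → E
  map_q {v w : V} (hv : Uni ω v) (h : ω v w = 0) (a : R) : π (q v w a) = heis ω v w a
  q_mul {v w w' : V} (hv : Uni ω v) (h : ω v w = 0) (h' : ω v w' = 0) (a b : R) :
    q v w a * q v w' b = q v (w + w') (a + b + ω w w')
  q_conj {v w : V} (hv : Uni ω v) (h : ω v w = 0) (a : R) (ε : E) :
    ε * q v w a * ε⁻¹ = q (π ε • v) (π ε • w) a
  q_scale {v w : V} (hv : Uni ω v) (h : ω v w = 0) (a : R) (c : Rˣ) :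
    q ((c : R) • v) w a = q v ((c : R) • w) (c ^ 2 * a)

namespace HeisLift

variable (L : HeisLift π)

/-- The lift of a transvection. -/
def τ (v : V) (a : R) : E := L.q v 0 a

theorem map_τ {v : V} (hv : Uni ω v) (a : R) : π (L.τ v a) = transv ω v a :=
  L.map_q hv (map_zero _) a

theorem τ_smul {v : V} (hv : Uni ω v) (a : R) (x : V) :
    π (L.τ v a) • x = x + (a * ω v x) • v := by
  rw [L.map_τ hv, transv_smul]

theorem q_smul {v w : V} (hv : Uni ω v) (h : ω v w = 0) (a : R) (x : V) :
    π (L.q v w a) • x = x + ω v x • w + ω w x • v + (a * ω v x) • v := by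
  rw [L.map_q hv h, heis_smul h]

theorem q_zero {v : V} (hv : Uni ω v) : L.q v 0 0 = 1 := by
  have := L.q_mul hv (map_zero _) (map_zero _) 0 0
  simpa using this

theorem q_inv {v w : V} (hv : Uni ω v) (h : ω v w = 0) (a : R) :
    (L.q v w a)⁻¹ = L.q v (-w) (-a) := by
  rw [inv_eq_iff_mul_eq_one, L.q_mul hv h (by simpa using h), ← L.q_zero hv]
  simp

theorem τ_add {v : V} (hv : Uni ω v) (a b : R) : L.τ v (a + b) = L.τ v a * L.τ v b := by
  rw [τ, τ, τ, L.q_mul hv (map_zero _) (map_zero _)]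
  simp

theorem τ_neg {v : V} (hv : Uni ω v) (a : R) : L.τ v (-a) = (L.τ v a)⁻¹ := by
  rw [τ, τ, L.q_inv hv (map_zero _)]
  simp

theorem τ_conj {v : V} (hv : Uni ω v) (a : R) (ε : E) :
    ε * L.τ v a * ε⁻¹ = L.τ (π ε • v) a := by
  rw [τ, τ, L.q_conj hv (map_zero _), smul_zero]

theorem τ_scale {v : V} (hv : Uni ω v) (a : R) (c : Rˣ) :
    L.τ ((c : R) • v) a = L.τ v (c ^ 2 * a) := by
  rw [τ, τ, L.q_scale hv (map_zero _), smul_zero]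

theorem q_eq_mul_τ {v w : V} (hv : Uni ω v) (h : ω v w = 0) (a : R) :
    L.q v w a = L.q v w 0 * L.τ v a := by
  rw [τ, L.q_mul hv h (map_zero _)]
  simp

/-- The transvection along `z + c y` for orthogonal `y` and `z`. -/
theorem τ_add_smul {y z u : V} (hy : Uni ω y) (hz : Uni ω z) (hyz : ω y z = 0) {c : R}
    (huy : ω y u = 0) (huz : ω u z = c) (a : R) :
    L.τ (z + c • y) a = L.q y ((a * c) • z) (a * c ^ 2) * L.τ z a := by
  have hyu' : ω y (-u) = 0 := by simpa using huy
  have hzu : ω z u = -c := by rw [form_swap, huz]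
  have h1 : π (L.q y u 0) • z = z + c • y := by
    rw [L.q_smul hy huy, hyz, huz]
    simp
  have hzy : ω z y = 0 := form_eq_zero_comm.1 hyz
  have h2 := L.q_conj hy hyu' 0 (L.τ z a)
  rw [L.τ_smul hz, L.τ_smul hz, hzy, map_neg, hzu] at h2
  have h3 := L.τ_conj hz a (L.q y u 0)
  rw [h1] at h3
  rw [← h3, L.q_inv hy huy, neg_zero]
  have h4 : L.τ z a * L.q y (-u) 0 = L.q y (-u + (a * c) • z) 0 * L.τ z a := by
    rw [← mul_inv_eq_iff_eq_mul, h2]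
    simp
  rw [mul_assoc, h4, ← mul_assoc, L.q_mul hy huy (by simp [hyu', hyz])]
  congr 2
  · module
  · simp [huz]
    ring

theorem commute_τ {y z : V} (hz : Uni ω z) (hyz : ω y z = 0) (hy : Uni ω y) (a b : R) :
    L.τ y a * L.τ z b = L.τ z b * L.τ y a := by
  have := L.τ_conj hz b (L.τ y a)
  rw [L.τ_smul hy, hyz] at this
  rw [← mul_inv_eq_iff_eq_mul, this]
  simp

theorem q_symm {y z u u' : V} (hy : Uni ω y) (hz : Uni ω z) (hyz : ω y z = 0)
    (huy : ω y u = 0) (huz : ω u z = 1) (huz' : ω z u' = 0) (huy' : ω u' y = 1) (a : R) :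
    L.q y (a • z) 0 = L.q z (a • y) 0 := by
  have hzy : ω z y = 0 := form_eq_zero_comm.1 hyz
  have h1 := L.τ_add_smul hy hz hyz huy huz a
  have h2 := L.τ_add_smul hz hy hzy huz' huy' a
  rw [one_smul] at h2
  rw [one_smul, add_comm, h2, mul_one, one_pow, mul_one, L.q_eq_mul_τ hz (by simp [hzy]),
    L.q_eq_mul_τ hy (by simp [hyz]), mul_assoc, mul_assoc, L.commute_τ hy hzy hz] at h1
  exact (mul_right_cancel h1).symm

theorem inverse_neg_of_isUnit {a : R} (h : IsUnit a) : Ring.inverse (-a) = -Ring.inverse a := by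
  obtain ⟨u, rfl⟩ := h
  rw [← Units.val_neg, Ring.inverse_unit, Ring.inverse_unit]
  simp

/-- The lift of the transvection moving `u` to an adjacent vector `v`. -/
noncomputable def edge (u v : V) : E := L.τ (v - u) (-Ring.inverse (ω u v))

theorem edge_smul {u v : V} (h : Adj ω u v) : π (L.edge u v) • u = v := by
  rw [edge, L.map_τ h.uni_sub, transv_sub_smul h]

theorem edge_conj {u v : V} (h : Adj ω u v) (ε : E) :
    ε * L.edge u v * ε⁻¹ = L.edge (π ε • u) (π ε • v) := by
  rw [edge, L.τ_conj h.uni_sub, edge, smul_sub, form_smul_smul]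

theorem edge_symm {u v : V} (h : Adj ω u v) : L.edge v u = (L.edge u v)⁻¹ := by
  have h1 := L.τ_scale (v := v - u) h.uni_sub (-Ring.inverse (ω v u)) (-1)
  rw [edge, edge, ← L.τ_neg h.uni_sub]
  simp only [Units.val_neg, Units.val_one, neg_smul, one_smul, neg_sub] at h1
  rw [h1, form_swap v u, inverse_neg_of_isUnit h]
  simp

/-- The subgroup generated by the lifts of the transvections along vectors of `U`. -/
def elem (U : Submodule R V) : Subgroup E :=
  Subgroup.closure {ε | ∃ u ∈ U, Uni ω u ∧ ∃ a, ε = L.τ u a}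

theorem τ_mem {U : Submodule R V} {u : V} (hu : u ∈ U) (h : Uni ω u) (a : R) :
    L.τ u a ∈ L.elem U := Subgroup.subset_closure ⟨u, hu, h, a, rfl⟩

theorem edge_mem {U : Submodule R V} {u v : V} (hu : u ∈ U) (hv : v ∈ U) (h : Adj ω u v) :
    L.edge u v ∈ L.elem U := L.τ_mem (U.sub_mem hv hu) h.uni_sub _

theorem elem_mono {U U' : Submodule R V} (h : U ≤ U') : L.elem U ≤ L.elem U' :=
  Subgroup.closure_mono fun _ ⟨u, hu, h'⟩ => ⟨u, h hu, h'⟩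

theorem conj_mem_elem {U U' : Submodule R V} {η : E} (h : ∀ u ∈ U, π η • u ∈ U') {ε : E}
    (hε : ε ∈ L.elem U) : η * ε * η⁻¹ ∈ L.elem U' := by
  have : L.elem U ≤ (L.elem U').comap (MulAut.conj η).toMonoidHom := by
    refine (Subgroup.closure_le _).2 ?_
    rintro _ ⟨u, hu, hu', a, rfl⟩
    simp only [Subgroup.coe_comap, Set.mem_preimage]
    change η * L.τ u a * η⁻¹ ∈ L.elem U'
    rw [L.τ_conj hu']
    exact L.τ_mem (h u hu) (hu'.smul _) a
  exact this hε

/-- Elements of `L.elem U` move vectors by elements of `U`. -/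
theorem elem_smul_sub_mem {U : Submodule R V} {ε : E} (hε : ε ∈ L.elem U) (x : V) :
    π ε • x - x ∈ U := by
  induction hε using Subgroup.closure_induction generalizing x with
  | mem ε h =>
    obtain ⟨u, hu, hu', a, rfl⟩ := h
    rw [L.τ_smul hu', add_sub_cancel_left]
    exact U.smul_mem _ hu
  | one => simp
  | mul ε η _ _ h1 h2 =>
    rw [map_mul, mul_smul]
    have := U.add_mem (h1 (π η • x)) (h2 x)
    simpa using this
  | inv ε _ h =>
    have := U.neg_mem (h ((π ε)⁻¹ • x))
    rw [map_inv]
    simpa using this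

theorem elem_smul_mem {U : Submodule R V} {ε : E} (hε : ε ∈ L.elem U) {x : V} (hx : x ∈ U) :
    π ε • x ∈ U := by
  have := U.add_mem (L.elem_smul_sub_mem hε x) hx
  simpa using this

theorem elem_smul_eq {U : Submodule R V} {ε : E} (hε : ε ∈ L.elem U) {x : V}
    (hx : ∀ u ∈ U, ω u x = 0) : π ε • x = x := by
  induction hε using Subgroup.closure_induction with
  | mem ε h =>
    obtain ⟨u, hu, hu', a, rfl⟩ := h
    rw [L.τ_smul hu', hx u hu]
    simp
  | one => simp
  | mul ε η _ _ h1 h2 => rw [map_mul, mul_smul, h2, h1]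
  | inv ε _ h => rw [map_inv, inv_smul_eq_iff, h]

/-- The kernel of `π` meets `L.elem U` trivially. -/
def Faithful (U : Submodule R V) : Prop := ∀ ε ∈ L.elem U, π ε = 1 → ε = 1

theorem Faithful.eq {L : HeisLift π} {U : Submodule R V} (h : L.Faithful U) {ε η : E}
    (hε : ε ∈ L.elem U) (hη : η ∈ L.elem U) (he : π ε = π η) : ε = η := by
  rw [← mul_inv_eq_one]
  exact h _ (mul_mem hε (inv_mem hη)) (by simp [he])

theorem Faithful.conj {L : HeisLift π} {U U' : Submodule R V} (h : L.Faithful U) {η : E}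
    (hη : ∀ u ∈ U', π η • u ∈ U) : L.Faithful U' := by
  intro ε hε h1
  have := h _ (L.conj_mem_elem hη hε) (by simp [h1])
  simpa using this

end HeisLift

/-- `U'` is the orthogonal sum of `U` and the hyperbolic plane spanned by `z` and `s`. -/
structure IsHypExt (ω : V →ₗ[R] V →ₗ[R] R) (U : Submodule R V) (z s : V) (U' : Submodule R V) :
    Prop where
  z_mem : z ∈ U'
  s_mem : s ∈ U'
  form : ω z s = 1
  le : U ≤ U'
  form_z : ∀ u ∈ U, ω z u = 0
  form_s : ∀ u ∈ U, ω s u = 0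
  sub_mem : ∀ x ∈ U', x - (ω x s • z + ω z x • s) ∈ U

/-- The vectors of `U` orthogonal to `u`. -/
def perp (ω : V →ₗ[R] V →ₗ[R] R) (U : Submodule R V) (u : V) : Submodule R V :=
  U ⊓ LinearMap.ker (ω u)

theorem mem_perp {U : Submodule R V} {u x : V} : x ∈ perp ω U u ↔ x ∈ U ∧ ω u x = 0 := by
  simp [perp]

/-- Every vector of `U` is a multiple of a unimodular vector of `U`. -/
def HasDiv (ω : V →ₗ[R] V →ₗ[R] R) (U : Submodule R V) : Prop :=
  ∀ r ∈ U, ∃ (c : R) (y : V), y ∈ U ∧ Uni ω y ∧ r = c • y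

namespace HeisLift

variable (L : HeisLift π)

theorem Faithful.perp_z [IsLocalRing R] {L : HeisLift π} {U U' : Submodule R V} {z s : V}
    (hF : L.Faithful U) (hX : IsHypExt ω U z s U') (hP : HasPartners ω U) (hD : HasDiv ω U) :
    L.Faithful (perp ω U' z) := by
  have hz : Uni ω z := ⟨s, hX.form⟩
  have hq : ∀ ε ∈ L.elem U, ∀ w ∈ U, ∀ a, ε * L.q z w a = L.q z (π ε • w) a * ε := by
    intro ε hε w hw a
    rw [← mul_inv_eq_iff_eq_mul, L.q_conj hz (hX.form_z w hw), L.elem_smul_eq hε]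
    intro u hu
    rw [form_swap, hX.form_z u hu, neg_zero]
  let S : Subgroup E :=
    { carrier := {η | ∃ w ∈ U, ∃ a, ∃ ε ∈ L.elem U, η = L.q z w a * ε}
      mul_mem' := by
        rintro _ _ ⟨w, hw, a, ε, hε, rfl⟩ ⟨w', hw', a', ε', hε', rfl⟩
        have hw2 := L.elem_smul_mem hε hw'
        refine ⟨_, U.add_mem hw hw2, a + a' + ω w (π ε • w'), _, mul_mem hε hε', ?_⟩
        rw [mul_assoc, ← mul_assoc ε, hq ε hε w' hw' a', mul_assoc, ← mul_assoc,
          L.q_mul hz (hX.form_z _ hw) (hX.form_z _ hw2)]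
      one_mem' := ⟨0, U.zero_mem, 0, 1, one_mem _, by simp [L.q_zero hz]⟩
      inv_mem' := by
        rintro _ ⟨w, hw, a, ε, hε, rfl⟩
        refine ⟨_, L.elem_smul_mem (inv_mem hε) (U.neg_mem hw), -a, _, inv_mem hε, ?_⟩
        rw [← hq _ (inv_mem hε) _ (U.neg_mem hw), _root_.mul_inv_rev, L.q_inv hz (hX.form_z _ hw)] }
  have hS : L.elem (perp ω U' z) ≤ S := by
    refine (Subgroup.closure_le _).2 ?_
    rintro _ ⟨u, hu, hu', a, rfl⟩
    obtain ⟨hu1, hu2⟩ := mem_perp.1 hu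
    obtain ⟨d, y, hy, hyU, hd⟩ := hD _ (hX.sub_mem u hu1)
    set c := ω u s with hc
    have hu3 : u = d • y + c • z := by
      rw [← hd, hu2]
      module
    obtain ⟨y', hy', hyy'⟩ := hP y hy hyU
    have hzy := hX.form_z y hy
    have hyz : ω y z = 0 := form_eq_zero_comm.1 hzy
    by_cases hdu : IsUnit d
    · obtain ⟨d, rfl⟩ := hdu
      have h1 : u = (d : R) • (y + ((↑d⁻¹ : R) * c) • z) := by
        rw [hu3, smul_add, smul_smul, ← mul_assoc]
        simp
      have h2 : Uni ω (y + ((↑d⁻¹ : R) * c) • z) := ⟨y', by simp [hyy', hX.form_z y' hy']⟩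
      rw [h1, L.τ_scale h2, L.τ_add_smul hz hyU hzy (u := (-((↑d⁻¹ : R) * c)) • y')
        (by simp [hX.form_z y' hy']) (by rw [form_swap]; simp [hyy'])]
      exact ⟨_, U.smul_mem _ hy, _, _, L.τ_mem hy hyU _, rfl⟩
    · have hcu : IsUnit c := by
        by_contra hcu
        obtain ⟨x, hx⟩ := hu'
        have h1 : ¬ IsUnit (ω u x) := by
          rw [hu3]
          simp only [map_add, map_smul, LinearMap.add_apply, LinearMap.smul_apply, smul_eq_mul]
          exact IsLocalRing.nonunits_add (fun h => hdu (isUnit_of_mul_isUnit_left h))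
            (fun h => hcu (isUnit_of_mul_isUnit_left h))
        rw [hx] at h1
        exact h1 isUnit_one
      clear_value c
      obtain ⟨c, rfl⟩ := hcu
      have h1 : u = (c : R) • (z + ((↑c⁻¹ : R) * d) • y) := by
        rw [hu3, smul_add, smul_smul, ← mul_assoc, add_comm]
        simp
      have hs : ω s y = 0 := hX.form_s y hy
      have hs' : ω y s = 0 := form_eq_zero_comm.1 hs
      have h2 : Uni ω (z + ((↑c⁻¹ : R) * d) • y) := ⟨s, by simp [hs', hX.form]⟩
      have hsz : ω s z = -1 := by rw [form_swap, hX.form]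
      have hy'y : ω y' y = -1 := by rw [form_swap, hyy']
      rw [h1, L.τ_scale h2, L.τ_add_smul hyU hz hyz (u := (-((↑c⁻¹ : R) * d)) • s)
        (by simp [hs']) (by simp [hsz]), L.q_eq_mul_τ hyU (by simp [hyz]),
        L.q_symm hyU hz hyz (u := -s) (u' := -y') (by simp [hs']) (by simp [hsz])
          (by simp [hX.form_z y' hy']) (by simp [hy'y]), mul_assoc,
          L.commute_τ hz hyz hyU, ← mul_assoc, ← L.q_eq_mul_τ hz (by simp [hzy])]
      exact ⟨_, U.smul_mem _ hy, _, _, L.τ_mem hy hyU _, rfl⟩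
  intro η hη h1
  obtain ⟨w, hw, a, ε, hε, rfl⟩ := hS hη
  have h2 : π (L.q z w a * ε) • s = s := by rw [h1, one_smul]
  have hws : ω w s = 0 := form_eq_zero_comm.1 (hX.form_s w hw)
  rw [map_mul, mul_smul, L.elem_smul_eq hε (fun u hu => form_eq_zero_comm.1 (hX.form_s u hu)),
    L.q_smul hz (hX.form_z w hw), hX.form, hws] at h2
  have h3 : w + a • z = 0 := by
    have := sub_eq_zero.2 h2
    rw [← this]
    module
  have h4 := congrArg (fun x => ω x s) h3
  simp only [map_add, map_smul, LinearMap.add_apply, LinearMap.smul_apply, smul_eq_mul, hws,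
    hX.form, map_zero, LinearMap.zero_apply] at h4
  have ha : a = 0 := by simpa using h4
  subst ha
  have hw0 : w = 0 := by simpa using h3
  subst hw0
  rw [L.q_zero hz, one_mul] at h1 ⊢
  exact hF ε hε h1

end HeisLift

end Symp

namespace Symp

variable {R V : Type*} [CommRing R] [AddCommGroup V] [Module R V]
variable {ω : V →ₗ[R] V →ₗ[R] R} [hω : Fact ω.IsAlt]
variable {E : Type*} [Group E] {π : E →* Sp ω}

namespace HeisLift

variable (L : HeisLift π)

section Transitivity

variable [IsLocalRing R] {U : Submodule R V}

theorem exists_elem_smul_eq (hU : HasPartners ω U) {u v : V} (hu : u ∈ U) (hv : v ∈ U)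
    (hu' : Uni ω u) (hv' : Uni ω v) : ∃ ε ∈ L.elem U, π ε • u = v := by
  obtain ⟨x, hx, hux, hvx⟩ := exists_adj₂ hU hu hv hu' hv'
  refine ⟨L.edge x v * L.edge u x, mul_mem (L.edge_mem hx hv hvx.symm) (L.edge_mem hu hx hux), ?_⟩
  rw [map_mul, mul_smul, L.edge_smul hux, L.edge_smul hvx.symm]

theorem edge_mem_perp {u v v' : V} (hv : v ∈ U) (hv' : v' ∈ U) (h : ω u v = ω u v')
    (ha : Adj ω v v') : L.edge v v' ∈ L.elem (perp ω U u) :=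
  L.τ_mem (mem_perp.2 ⟨U.sub_mem hv' hv, by simp [h]⟩) ha.uni_sub _

theorem exists_elem_perp_smul_eq {u v v' : V} (hu : u ∈ U) (hv : v ∈ U) (hv' : v' ∈ U)
    (huv : Adj ω u v) (h : ω u v = ω u v') : ∃ ε ∈ L.elem (perp ω U u), π ε • v = v' := by
  by_cases hvv : Adj ω v v'
  · exact ⟨L.edge v v', L.edge_mem_perp hv hv' h hvv, L.edge_smul hvv⟩
  · have h1 : Adj ω v (v + u) := by
      rw [Adj, map_add, form_self, zero_add]
      exact huv.symm
    have h2 : Adj ω (v + u) v' := by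
      rw [Adj, map_add, LinearMap.add_apply, ← h]
      exact isUnit_add_of_not_left hvv huv
    refine ⟨L.edge (v + u) v' * L.edge v (v + u), mul_mem (L.edge_mem_perp (U.add_mem hv hu) hv'
      (by simp [h]) h2) (L.edge_mem_perp hv (U.add_mem hv hu) (by simp) h1), ?_⟩
    rw [map_mul, mul_smul, L.edge_smul h1, L.edge_smul h2]

theorem elem_perp_smul {u : V} {ε : E} (hε : ε ∈ L.elem (perp ω U u)) : π ε • u = u :=
  L.elem_smul_eq hε fun _ hx => form_eq_zero_comm.1 (mem_perp.1 hx).2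

theorem elem_perp_le (u : V) : L.elem (perp ω U u) ≤ L.elem U := L.elem_mono inf_le_left

/-- `L.elem U` is transitive on pairs of adjacent vectors with a given value of the form. -/
theorem exists_elem_smul_pair (hU : HasPartners ω U) {u v u' v' : V} (hu : u ∈ U) (hv : v ∈ U)
    (hu' : u' ∈ U) (hv' : v' ∈ U) (huv : Adj ω u v) (h : ω u v = ω u' v') :
    ∃ ε ∈ L.elem U, π ε • u = u' ∧ π ε • v = v' := by
  have huv' : Adj ω u' v' := by rwa [Adj, ← h]
  obtain ⟨ε, hε, hεu⟩ := L.exists_elem_smul_eq hU hu hu' huv.uni_left huv'.uni_left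
  obtain ⟨η, hη, hηv⟩ := L.exists_elem_perp_smul_eq (u := u') hu' (L.elem_smul_mem hε hv) hv'
    (by rw [← hεu]; exact huv.smul _) (by rw [← h, ← form_smul_smul (π ε) u v, hεu])
  refine ⟨η * ε, mul_mem (L.elem_perp_le _ hη) hε, ?_, ?_⟩
  · rw [map_mul, mul_smul, hεu, L.elem_perp_smul hη]
  · rw [map_mul, mul_smul, hηv]

theorem Faithful.perp {L : HeisLift π} {U' : Submodule R V} {z s : V}
    (hF : L.Faithful U) (hX : IsHypExt ω U z s U') (hP : HasPartners ω U) (hD : HasDiv ω U)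
    (hP' : HasPartners ω U') {u : V} (hu : u ∈ U') (hu' : Uni ω u) :
    L.Faithful (perp ω U' u) := by
  obtain ⟨ε, hε, hεu⟩ := L.exists_elem_smul_eq hP' hu hX.z_mem hu' ⟨s, hX.form⟩
  apply (hF.perp_z hX hP hD).conj (η := ε)
  intro x hx
  obtain ⟨h1, h2⟩ := mem_perp.1 hx
  exact mem_perp.2 ⟨L.elem_smul_mem hε h1, by rw [← hεu, form_smul_smul, h2]⟩

end Transitivity

theorem inverse_eq_of_mul_eq_one {a b : R} (h : a * b = 1) : Ring.inverse a = b := by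
  have ha : IsUnit a := .of_mul_eq_one _ h
  calc Ring.inverse a = Ring.inverse a * (a * b) := by rw [h, mul_one]
    _ = b := by rw [← mul_assoc, Ring.inverse_mul_cancel _ ha, one_mul]

theorem triangle_mem_of_normalForm [IsLocalRing R] {U : Submodule R V} {u v y w : V} {α β c X D : R}
    (hu : u ∈ U)
    (hv : v ∈ U) (hy : y ∈ U) (hyU : Uni ω y) (hyu : ω y u = 0) (hyv : ω y v = 0)
    (hX : ω u v = X) (hD : D * X * α * β = 1) (hw : w = α • u + β • v + c • y)
    (hF : L.Faithful (perp ω U y)) :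
    L.edge w u * L.edge v w * L.edge u v ∈ L.elem (perp ω U u) := by
  have huy : ω u y = 0 := form_eq_zero_comm.1 hyu
  have hvy : ω v y = 0 := form_eq_zero_comm.1 hyv
  have hvu : ω v u = -X := by rw [form_swap, hX]
  have huv : Adj ω u v := by
    rw [Adj, hX]
    exact .of_mul_eq_one (D * α * β) (by linear_combination hD)
  have hvw' : ω v w = -(X * α) := by
    rw [hw]
    simp [hvu, hvy]
    ring
  have hvw : Adj ω v w := by
    rw [Adj, hvw']
    exact .of_mul_eq_one (-(D * β)) (by linear_combination hD)
  have hwu' : ω w u = -(X * β) := by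
    rw [hw]
    simp [hvu, hyu]
    ring
  have hwu : Adj ω w u := by
    rw [Adj, hwu']
    exact .of_mul_eq_one (-(D * α)) (by linear_combination hD)
  have hwU : w ∈ U := by
    rw [hw]
    exact U.add_mem (U.add_mem (U.smul_mem _ hu) (U.smul_mem _ hv)) (U.smul_mem _ hy)
  have hyw : ω y w = 0 := by
    rw [hw]
    simp [hyu, hyv]
  have huyU : Uni ω (u + y) := by
    apply uni_of_isUnit (y := v)
    rw [map_add, LinearMap.add_apply, hyv, add_zero]
    exact huv
  have huU : Uni ω u := huv.uni_left
  set k := α + β - 1 with hk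
  have hu1 : u ∈ Symp.perp ω U u := mem_perp.2 ⟨hu, form_self u⟩
  have hy1 : y ∈ Symp.perp ω U u := mem_perp.2 ⟨hy, huy⟩
  have hu2 : u ∈ Symp.perp ω U y := mem_perp.2 ⟨hu, hyu⟩
  have hy2 : y ∈ Symp.perp ω U y := mem_perp.2 ⟨hy, form_self y⟩
  have key : L.edge w u * L.edge v w * L.edge u v =
      L.τ u (D * k ^ 2 - D * k * c) * L.τ y (D * c ^ 2 - D * k * c) * L.τ (u + y) (D * k * c) := by
    apply hF.eq
    · exact mul_mem (mul_mem (L.edge_mem_perp hwU hu (by rw [hyw, hyu]) hwu)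
        (L.edge_mem_perp hv hwU (by rw [hyw, hyv]) hvw))
        (L.edge_mem_perp hu hv (by rw [hyu, hyv]) huv)
    · exact mul_mem (mul_mem (L.τ_mem hu2 huU _) (L.τ_mem hy2 hyU _))
        (L.τ_mem (Submodule.add_mem _ hu2 hy2) huyU _)
    · apply Sp.ext
      intro x
      have e1 : Ring.inverse (ω u v) = D * α * β :=
        inverse_eq_of_mul_eq_one (by rw [hX]; linear_combination hD)
      have e2 : Ring.inverse (ω v w) = -(D * β) :=
        inverse_eq_of_mul_eq_one (by rw [hvw']; linear_combination hD)
      have e3 : Ring.inverse (ω w u) = -(D * α) :=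
        inverse_eq_of_mul_eq_one (by rw [hwu']; linear_combination hD)
      simp only [map_mul, mul_smul, edge, e1, e2, e3]
      rw [L.τ_smul huyU, L.τ_smul hyU, L.τ_smul huU, L.τ_smul huv.uni_sub, L.τ_smul hvw.uni_sub,
        L.τ_smul hwu.uni_sub]
      simp only [hw, map_add, map_smul, map_sub, LinearMap.add_apply, LinearMap.smul_apply,
        LinearMap.sub_apply, smul_eq_mul, form_self, hX, hvu, huy, hyu, hvy, hyv]
      generalize ω u x = P
      generalize ω v x = Q
      generalize ω y x = S
      match_scalars <;> grind
  rw [key]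
  exact mul_mem (mul_mem (L.τ_mem hu1 huU _) (L.τ_mem hy1 hyU _))
    (L.τ_mem (Submodule.add_mem _ hu1 hy1) huyU _)

end HeisLift

end Symp

namespace Symp

variable {R V : Type*} [CommRing R] [AddCommGroup V] [Module R V]
variable {ω : V →ₗ[R] V →ₗ[R] R} [hω : Fact ω.IsAlt]
variable {E : Type*} [Group E] {π : E →* Sp ω} [IsLocalRing R]

namespace HeisLift

variable (L : HeisLift π)

/-- Closed paths along triangles in `U` belong to the group generated by the transvections of `U`
fixing the base point. -/
def TrianglesClose (U : Submodule R V) : Prop :=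
  ∀ u ∈ U, ∀ v ∈ U, ∀ w ∈ U, Adj ω u v → Adj ω v w → Adj ω w u →
    L.edge w u * L.edge v w * L.edge u v ∈ L.elem (perp ω U u)

theorem Faithful.trianglesClose {L : HeisLift π} {U U' : Submodule R V} {z s : V}
    (hF : L.Faithful U) (hX : IsHypExt ω U z s U') (hP : HasPartners ω U) (hD : HasDiv ω U)
    (hP' : HasPartners ω U') : L.TrianglesClose U' := by
  intro u hu v hv w hw huv hvw hwu
  set X := ω u v with hXdef
  obtain ⟨ε, hε, hεu, hεv⟩ := L.exists_elem_smul_pair hP' hu hv hX.z_mem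
    (U'.smul_mem X hX.s_mem) huv (by simp [hX.form, X])
  set w' := π ε • w with hw'
  have hwU : w' ∈ U' := L.elem_smul_mem hε hw
  obtain ⟨c, y, hy, hyU, hc⟩ := hD _ (hX.sub_mem w' hwU)
  obtain ⟨X, hXu⟩ := huv
  rw [← hXdef] at hXu
  rw [← hXu] at hεv
  have hwz : IsUnit (ω z w') := by
    rw [← hεu, form_smul_smul]
    exact hwu.symm
  have hws : IsUnit (ω w' s) := by
    have h1 : IsUnit (ω ((X : R) • s) w') := by
      rw [← hεv, form_smul_smul]
      exact hvw
    have h2 : IsUnit (ω s w') := by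
      simpa using h1
    rw [form_swap]
    exact h2.neg
  obtain ⟨β, hβ⟩ := hwz
  obtain ⟨α, hα⟩ := hws
  have key := L.triangle_mem_of_normalForm (u := z) (v := (X : R) • s) (y := y) (w := w')
    (α := α) (β := (↑(X⁻¹ * β) : R)) (c := c) (X := X) (D := ↑(α⁻¹ * β⁻¹)) hX.z_mem
    (U'.smul_mem _ hX.s_mem) (hX.le hy) hyU (form_eq_zero_comm.1 (hX.form_z y hy))
    (by simp [form_eq_zero_comm.1 (hX.form_s y hy)]) (by simp [hX.form])
    (by
      have : α⁻¹ * β⁻¹ * X * α * (X⁻¹ * β) = 1 := by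
        calc α⁻¹ * β⁻¹ * X * α * (X⁻¹ * β) = (α⁻¹ * α) * (β⁻¹ * β) * (X * X⁻¹) := by ac_rfl
          _ = 1 := by simp
      rw [← Units.val_mul, ← Units.val_mul, ← Units.val_mul, this, Units.val_one])
    (by
      clear_value w'
      rw [← hc, hα, smul_smul, ← Units.val_mul, mul_comm _ X, mul_inv_cancel_left, hβ]
      module)
    (hF.perp hX hP hD hP' (hX.le hy) hyU)
  rw [← hεu, ← hεv, hw', ← L.edge_conj hwu, ← L.edge_conj hvw, ← L.edge_conj (by
    rw [Adj, ← hXdef, ← hXu]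
    exact X.isUnit)] at key
  have h1 := L.conj_mem_elem (U' := Symp.perp ω U' u) (η := ε⁻¹) (by
    intro x hx
    obtain ⟨h1, h2⟩ := mem_perp.1 hx
    refine mem_perp.2 ⟨L.elem_smul_mem (inv_mem hε) h1, ?_⟩
    rw [← form_smul_smul (π ε), map_inv, smul_inv_smul, h2]) key
  convert h1 using 1
  group

section Covering

variable {L : HeisLift π} {U : Submodule R V} {v₀ : V}

/-- Elements differing from a path of length two from `v₀` to `π ε • v₀` by an element of the group
generated by the transvections of `U` fixing `v₀`. -/
def IsPathLift (L : HeisLift π) (U : Submodule R V) (v₀ : V) (ε : E) : Prop :=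
  ∃ x ∈ U, Adj ω v₀ x ∧ Adj ω (π ε • v₀) x ∧
    ∃ h ∈ L.elem (perp ω U v₀), ε = L.edge x (π ε • v₀) * L.edge v₀ x * h

variable (hT : L.TrianglesClose U) (hv₀ : v₀ ∈ U)
include hT hv₀

theorem TrianglesClose.exists_edge_mul {x y : V} (hx : x ∈ U) (hy : y ∈ U) (h1 : Adj ω v₀ x)
    (h2 : Adj ω x y) (h3 : Adj ω v₀ y) :
    ∃ h ∈ L.elem (perp ω U v₀), L.edge x y * L.edge v₀ x = L.edge v₀ y * h := by
  refine ⟨_, hT v₀ hv₀ x hx y hy h1 h2 h3.symm, ?_⟩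
  rw [L.edge_symm h3]
  group

theorem TrianglesClose.exists_path_eq_of_adj {x x' v : V} (hx : x ∈ U) (hx' : x' ∈ U) (hv : v ∈ U)
    (h1 : Adj ω v₀ x) (h2 : Adj ω v x) (h1' : Adj ω v₀ x') (h2' : Adj ω v x') (h : Adj ω x x') :
    ∃ k ∈ L.elem (perp ω U v₀),
      L.edge x v * L.edge v₀ x = L.edge x' v * L.edge v₀ x' * k := by
  obtain ⟨k, hk, hk'⟩ := hT.exists_edge_mul hv₀ hx hx' h1 h h1'
  have h3 := hT x' hx' x hx v hv h.symm h2.symm h2'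
  have h4 := L.conj_mem_elem (U' := perp ω U v₀) (η := L.edge x' v₀) (by
    intro u hu
    obtain ⟨hu1, hu2⟩ := mem_perp.1 hu
    refine mem_perp.2 ⟨L.elem_smul_mem (L.edge_mem hx' hv₀ h1'.symm) hu1, ?_⟩
    rw [← hu2, ← form_smul_smul (π (L.edge x' v₀)) x', L.edge_smul h1'.symm]) h3
  refine ⟨_, mul_mem h4 hk, ?_⟩
  have h5 : k = L.edge x' v₀ * (L.edge x x' * L.edge v₀ x) := by
    rw [hk', L.edge_symm h1']
    group
  rw [h5, L.edge_symm h1', L.edge_symm h, L.edge_symm h2']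
  group

theorem TrianglesClose.exists_path_eq (two : IsUnit (2 : R)) {x x' v : V} (hx : x ∈ U)
    (hx' : x' ∈ U) (hv : v ∈ U) (h1 : Adj ω v₀ x) (h2 : Adj ω v x) (h1' : Adj ω v₀ x')
    (h2' : Adj ω v x') : ∃ k ∈ L.elem (perp ω U v₀),
      L.edge x v * L.edge v₀ x = L.edge x' v * L.edge v₀ x' * k := by
  by_cases hvv : Adj ω v₀ v
  · obtain ⟨k, hk, hk'⟩ := hT.exists_edge_mul hv₀ hx hv h1 h2.symm hvv
    obtain ⟨l, hl, hl'⟩ := hT.exists_edge_mul hv₀ hx' hv h1' h2'.symm hvv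
    refine ⟨l⁻¹ * k, mul_mem (inv_mem hl) hk, ?_⟩
    rw [hk', hl']
    group
  · have hvv' : ¬ Adj ω v v₀ := fun h => hvv h.symm
    obtain ⟨t, ht, t0, tv, tx, tx'⟩ : ∃ t ∈ U, Adj ω v₀ t ∧ Adj ω v t ∧ Adj ω x t ∧ Adj ω t x' := by
      rcases isUnit_add_or_isUnit_sub two h1' (ω x x') with h | h
      · refine ⟨x + v₀, U.add_mem hx hv₀, ?_, ?_, ?_, ?_⟩
        · rw [Adj, map_add, form_self, add_zero]
          exact h1
        · rw [Adj, map_add]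
          exact isUnit_add_of_not h2 hvv'
        · rw [Adj, map_add, form_self, zero_add]
          exact h1.symm
        · rwa [Adj, map_add, LinearMap.add_apply, add_comm]
      · refine ⟨x - v₀, U.sub_mem hx hv₀, ?_, ?_, ?_, ?_⟩
        · rw [Adj, map_sub, form_self, sub_zero]
          exact h1
        · rw [Adj, map_sub]
          exact isUnit_sub_of_not h2 hvv'
        · rw [Adj, map_sub, form_self, zero_sub]
          exact h1.symm.neg
        · rw [Adj, map_sub, LinearMap.sub_apply]
          simpa using h.neg
    obtain ⟨k, hk, hk'⟩ := hT.exists_path_eq_of_adj hv₀ hx ht hv h1 h2 t0 tv tx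
    obtain ⟨l, hl, hl'⟩ := hT.exists_path_eq_of_adj hv₀ ht hx' hv t0 tv h1' h2' tx'
    refine ⟨l * k, mul_mem hl hk, ?_⟩
    rw [hk', hl']
    group

omit hT hv₀ in
theorem IsPathLift.mul_left {ε h : E} (hε : IsPathLift L U v₀ ε)
    (hh : h ∈ L.elem (perp ω U v₀)) : IsPathLift L U v₀ (h * ε) := by
  obtain ⟨x, hx, h1, h2, k, hk, he⟩ := hε
  have h0 : π h • v₀ = v₀ := L.elem_perp_smul hh
  refine ⟨π h • x, L.elem_smul_mem (L.elem_perp_le _ hh) hx, ?_, ?_, h * k, mul_mem hh hk, ?_⟩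
  · rw [← h0]
    exact h1.smul _
  · rw [map_mul, mul_smul]
    exact h2.smul _
  · rw [show L.edge v₀ (π h • x) = L.edge (π h • v₀) (π h • x) by rw [h0], map_mul,
      mul_smul, ← L.edge_conj h1, ← L.edge_conj h2.symm]
    nth_rw 1 [he]
    group

theorem IsPathLift.edge_mul (two : IsUnit (2 : R)) (hP : HasPartners ω U) {ε : E} {y : V}
    (hε : IsPathLift L U v₀ ε) (hεU : ε ∈ L.elem U) (hy : y ∈ U) (hyv : Adj ω v₀ y) :
    IsPathLift L U v₀ (L.edge v₀ y * ε) := by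
  obtain ⟨x', hx', h1', h2', k, hk, he⟩ := hε
  set g := L.edge v₀ y with hg
  have hgU : g ∈ L.elem U := L.edge_mem hv₀ hy hyv
  have hvU : π ε • v₀ ∈ U := L.elem_smul_mem hεU hv₀
  obtain ⟨x, hx, h1, h2, h3⟩ := exists_adj₃ hP two hv₀ hvU (c := π g⁻¹ • v₀)
    (L.elem_smul_mem (inv_mem hgU) hv₀) hyv.uni_left (hyv.uni_left.smul _) (hyv.uni_left.smul _)
  obtain ⟨l, hl, hl'⟩ := hT.exists_path_eq hv₀ two hx' hx hvU h1' h2' h1 h2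
  have hgv : π g • v₀ = y := L.edge_smul hyv
  have hgx : Adj ω v₀ (π g • x) := by
    rw [← adj_smul_iff (π g⁻¹), map_inv, inv_smul_smul, ← map_inv]
    exact h3
  have hyx : Adj ω y (π g • x) := by
    rw [← hgv]
    exact h1.smul _
  have hgxU : π g • x ∈ U := L.elem_smul_mem hgU hx
  obtain ⟨m, hm, hm'⟩ := hT.exists_edge_mul hv₀ hy hgxU hyv hyx hgx
  refine ⟨π g • x, hgxU, hgx, ?_, m * l * k, mul_mem (mul_mem hm hl) hk, ?_⟩
  · rw [map_mul, mul_smul]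
    exact h2.smul _
  · have e1 : m = (L.edge v₀ (π g • x))⁻¹ * (L.edge y (π g • x) * g) := by
      rw [hm']
      group
    have e2 : L.edge y (π g • x) = g * L.edge v₀ x * g⁻¹ := by
      rw [L.edge_conj h1, hgv]
    rw [map_mul, mul_smul, e1, e2, ← L.edge_conj h2.symm]
    nth_rw 1 [he]
    rw [hl']
    group

omit hT hv₀ in
theorem edge_sub_eq_inv {y : V} (h : Adj ω v₀ y) : L.edge v₀ (2 • v₀ - y) = (L.edge v₀ y)⁻¹ := by
  rw [← L.edge_symm h, edge, edge]
  congr 1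
  · module
  · rw [form_swap y]
    simp

omit hT in
theorem elem_le_closure (hP : HasPartners ω U) (hU₀ : Uni ω v₀) :
    L.elem U ≤ Subgroup.closure {ε | ∃ y ∈ U, Adj ω v₀ y ∧ ε = L.edge v₀ y} := by
  set K := Subgroup.closure {ε | ∃ y ∈ U, Adj ω v₀ y ∧ ε = L.edge v₀ y} with hK
  have hunit : ∀ u ∈ U, Adj ω u v₀ → ∀ a : Rˣ, L.τ u a ∈ K := by
    intro u hu h a
    obtain ⟨b, hb⟩ := id h
    have h1 : Adj ω v₀ (v₀ + (↑(a * b) : R) • u) := by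
      rw [Adj, map_add, form_self, zero_add, map_smul, form_swap, ← hb, ← Units.val_neg,
        smul_eq_mul, ← Units.val_mul]
      exact Units.isUnit _
    have h2 : L.τ u a = L.edge v₀ (v₀ + (↑(a * b) : R) • u) := by
      rw [edge, add_sub_cancel_left, L.τ_scale h.uni_left]
      congr 1
      rw [map_add, form_self, zero_add, map_smul, form_swap, ← hb, ← Units.val_neg, smul_eq_mul,
        ← Units.val_mul, Ring.inverse_unit, ← Units.val_neg, ← Units.val_pow_eq_pow_val,
        ← Units.val_mul]
      congr 1
      rw [mul_neg, mul_neg, inv_neg, mul_neg, neg_neg, eq_mul_inv_iff_mul_eq, pow_two]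
      ac_rfl
    rw [h2]
    exact Subgroup.subset_closure ⟨_, U.add_mem hv₀ (U.smul_mem _ hu), h1, rfl⟩
  have hadj : ∀ u ∈ U, Adj ω u v₀ → ∀ a : R, L.τ u a ∈ K := by
    intro u hu h a
    by_cases ha : IsUnit a
    · obtain ⟨a, rfl⟩ := ha
      exact hunit u hu h a
    · obtain ⟨b, hb⟩ : IsUnit (a - 1) := isUnit_sub_of_not_left ha isUnit_one
      have := mul_mem (hunit u hu h b) (hunit u hu h 1)
      rw [← L.τ_add h.uni_left, hb] at this
      simpa using this
  refine (Subgroup.closure_le _).2 ?_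
  rintro _ ⟨u, hu, hu', a, rfl⟩
  obtain ⟨x, hx, h1, h2⟩ := exists_adj₂ hP hv₀ hu hU₀ hu'
  have hm : L.edge v₀ x ∈ K := Subgroup.subset_closure ⟨x, hx, h1, rfl⟩
  have h3 := hadj (π (L.edge v₀ x)⁻¹ • u)
    (L.elem_smul_mem (inv_mem (L.edge_mem hv₀ hx h1)) hu) (by
      rw [← adj_smul_iff (π (L.edge v₀ x)), map_inv, smul_inv_smul, L.edge_smul h1]
      exact h2) a
  have h4 := mul_mem (mul_mem hm h3) (inv_mem hm)
  rw [L.τ_conj (hu'.smul _), map_inv, smul_inv_smul] at h4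
  exact h4

theorem TrianglesClose.faithful (two : IsUnit (2 : R)) (hP : HasPartners ω U) (hU₀ : Uni ω v₀)
    (hF : L.Faithful (perp ω U v₀)) : L.Faithful U := by
  have key : ∀ ε ∈ Subgroup.closure {ε | ∃ y ∈ U, Adj ω v₀ y ∧ ε = L.edge v₀ y},
      ε ∈ L.elem U ∧ IsPathLift L U v₀ ε := by
    intro ε hε
    induction hε using Subgroup.closure_induction_left with
    | one =>
      refine ⟨one_mem _, ?_⟩
      obtain ⟨x, hx, h1⟩ := hP v₀ hv₀ hU₀
      have h2 : Adj ω v₀ x := by simp [Adj, h1]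
      refine ⟨x, hx, h2, by simpa using h2, 1, one_mem _, ?_⟩
      rw [map_one, one_smul, L.edge_symm h2]
      group
    | mul_left η hη ε _ ih =>
      obtain ⟨y, hy, h1, rfl⟩ := hη
      exact ⟨mul_mem (L.edge_mem hv₀ hy h1) ih.1, ih.2.edge_mul hT hv₀ two hP ih.1 hy h1⟩
    | inv_mul_cancel η hη ε _ ih =>
      obtain ⟨y, hy, h1, rfl⟩ := hη
      have h2 : Adj ω v₀ (2 • v₀ - y) := by
        rw [Adj, map_sub, map_nsmul, form_self, smul_zero, zero_sub]
        exact h1.neg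
      rw [← edge_sub_eq_inv h1]
      have hy' : 2 • v₀ - y ∈ U := U.sub_mem (U.smul_of_tower_mem _ hv₀) hy
      exact ⟨mul_mem (L.edge_mem hv₀ hy' h2) ih.1, ih.2.edge_mul hT hv₀ two hP ih.1 hy' h2⟩
  intro ε hε h1
  obtain ⟨-, x, hx, h2, h3, k, hk, he⟩ := key ε (elem_le_closure hv₀ hP hU₀ hε)
  rw [h1, one_smul, L.edge_symm h2] at he
  have : ε = k := by
    rw [he]
    group
  subst this
  exact hF ε hk h1

end Covering

theorem Faithful.hypExt {L : HeisLift π} (two : IsUnit (2 : R)) {U U' : Submodule R V} {z s : V}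
    (hF : L.Faithful U) (hX : IsHypExt ω U z s U') (hP : HasPartners ω U) (hD : HasDiv ω U)
    (hP' : HasPartners ω U') : L.Faithful U' :=
  (hF.trianglesClose hX hP hD hP').faithful hX.z_mem two hP' ⟨s, hX.form⟩
    (hF.perp_z hX hP hD)

end HeisLift

end Symp

namespace Symp

/-- Two one-parameter subgroups indexed by a ring. -/
structure RootPair (R E : Type*) [CommRing R] [Group E] where
  /-- The positive root subgroup. -/
  x : R → E
  /-- The negative root subgroup. -/
  y : R → E
  x_add (a b : R) : x (a + b) = x a * x b
  y_add (a b : R) : y (a + b) = y a * y b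

namespace RootPair

variable {R E : Type*} [CommRing R] [Group E] (S : RootPair R E)

theorem x_zero : S.x 0 = 1 := by
  have := S.x_add 0 0
  simpa using this

theorem y_zero : S.y 0 = 1 := by
  have := S.y_add 0 0
  simpa using this

theorem x_neg (a : R) : S.x (-a) = (S.x a)⁻¹ := by
  rw [eq_inv_iff_mul_eq_one, ← S.x_add, neg_add_cancel, S.x_zero]

theorem y_neg (a : R) : S.y (-a) = (S.y a)⁻¹ := by
  rw [eq_inv_iff_mul_eq_one, ← S.y_add, neg_add_cancel, S.y_zero]

/-- The Weyl element. -/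
def w (u : Rˣ) : E := S.x u * S.y (-(↑u⁻¹ : R)) * S.x u

/-- The torus element. -/
def h (u : Rˣ) : E := S.w u * (S.w 1)⁻¹

theorem w_neg (u : Rˣ) : S.w (-u) = (S.w u)⁻¹ := by
  rw [w, w, inv_neg]
  simp only [Units.val_neg, x_neg, y_neg, _root_.mul_inv_rev, inv_inv, mul_assoc]

theorem h_one : S.h 1 = 1 := mul_inv_cancel _

theorem w_eq_h_mul (u : Rˣ) : S.w u = S.h u * S.w 1 := by simp [h]

/-- The relations satisfied by the root subgroups in extensions of `SL₂`. -/
structure IsWeyl : Prop where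
  w_x (u : Rˣ) (a : R) : S.w u * S.x a * (S.w u)⁻¹ = S.y (-((↑u⁻¹ : R) ^ 2 * a))
  w_y (u : Rˣ) (b : R) : S.w u * S.y b * (S.w u)⁻¹ = S.x (-((u : R) ^ 2 * b))
  h_comm (u v : Rˣ) : S.h u * S.h v = S.h v * S.h u

variable {S} (hS : S.IsWeyl)
include hS

namespace IsWeyl

theorem w_mul_x (u : Rˣ) (a : R) : S.w u * S.x a = S.y (-((↑u⁻¹ : R) ^ 2 * a)) * S.w u := by
  rw [← hS.w_x, inv_mul_cancel_right]

theorem w_mul_y (u : Rˣ) (b : R) : S.w u * S.y b = S.x (-((u : R) ^ 2 * b)) * S.w u := by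
  rw [← hS.w_y, inv_mul_cancel_right]

theorem w_eq (u : Rˣ) : S.w u = S.y (-(↑u⁻¹ : R)) * S.x u * S.y (-(↑u⁻¹ : R)) := by
  have h1 : S.w u = S.w u * S.w u * (S.w u)⁻¹ := by group
  have h2 : S.w u * S.w u * (S.w u)⁻¹ = (S.w u * S.x u * (S.w u)⁻¹) *
      (S.w u * S.y (-(↑u⁻¹ : R)) * (S.w u)⁻¹) * (S.w u * S.x u * (S.w u)⁻¹) := by
    nth_rw 2 [w]
    group
  have hu := Units.mul_inv u
  rw [h1, h2, hS.w_x, hS.w_y]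
  congr 3 <;> grind

theorem h_mul_x (u : Rˣ) (a : R) : S.h u * S.x a = S.x ((u : R) ^ 2 * a) * S.h u := by
  have h1 : (S.w 1)⁻¹ * S.x a = S.y (-a) * (S.w 1)⁻¹ := by
    rw [← S.w_neg, hS.w_mul_x]
    simp
  rw [h, mul_assoc, h1, ← mul_assoc, hS.w_mul_y, mul_assoc]
  simp

theorem h_mul_y (u : Rˣ) (b : R) : S.h u * S.y b = S.y ((↑u⁻¹ : R) ^ 2 * b) * S.h u := by
  have h1 : (S.w 1)⁻¹ * S.y b = S.x (-b) * (S.w 1)⁻¹ := by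
    rw [← S.w_neg, hS.w_mul_y]
    simp
  rw [h, mul_assoc, h1, ← mul_assoc, hS.w_mul_x, mul_assoc]
  simp

theorem x_mul_h (u : Rˣ) (a : R) : S.x a * S.h u = S.h u * S.x ((↑u⁻¹ : R) ^ 2 * a) := by
  rw [hS.h_mul_x, ← mul_assoc, ← mul_pow]
  simp

theorem h_mul_w (u v : Rˣ) : S.h v * S.w u = S.w (v ^ 2 * u) * S.h v := by
  rw [w, ← mul_assoc, ← mul_assoc, hS.h_mul_x, mul_assoc _ (S.h v), hS.h_mul_y, ← mul_assoc,
    mul_assoc _ (S.h v), hS.h_mul_x, ← mul_assoc, w]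
  congr 3
  rw [mul_inv, ← inv_pow]
  push_cast
  ring_nf

theorem h_sq_mul (u v : Rˣ) : S.h (v ^ 2 * u) = S.h (v ^ 2) * S.h u := by
  have h1 : S.h v * S.h u = S.h (v ^ 2 * u) * (S.h (v ^ 2))⁻¹ * S.h v := by
    have h2 : S.h v * (S.w 1)⁻¹ = (S.w (v ^ 2))⁻¹ * S.h v := by
      rw [← S.w_neg, ← S.w_neg, hS.h_mul_w]
      simp
    have h3 : S.h (v ^ 2 * u) * (S.h (v ^ 2))⁻¹ = S.w (v ^ 2 * u) * (S.w (v ^ 2))⁻¹ := by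
      simp only [h]
      group
    change S.h v * (S.w u * (S.w 1)⁻¹) = _
    rw [h3, ← mul_assoc, hS.h_mul_w, mul_assoc, h2, mul_assoc]
  rw [hS.h_comm v u] at h1
  have h3 := mul_right_cancel h1
  rw [eq_mul_inv_iff_mul_eq, hS.h_comm] at h3
  exact h3.symm

theorem w_one_eq {u v : Rˣ} (huv : (u : R) + v = 1) : S.w 1 = S.w u * S.w (-(u * v)) * S.w v := by
  have hu := Units.mul_inv u
  have hv := Units.mul_inv v
  have h1 : S.w 1 = S.y (-1) * (S.x u * S.x v) * S.y (-1) := by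
    rw [← S.x_add, huv, hS.w_eq]
    simp
  have h2 : ∀ t : Rˣ, S.x t = S.y (↑t⁻¹ : R) * S.w t * S.y (↑t⁻¹ : R) := by
    intro t
    rw [hS.w_eq, y_neg]
    group
  have h3 : S.y (-1) * S.y (↑u⁻¹ : R) * S.w u = S.w u * S.x (-(u * v : R)) := by
    rw [hS.w_mul_x, ← S.y_add]
    congr 2
    grind
  have h4 : S.w v * (S.y (↑v⁻¹ : R) * S.y (-1)) = S.x (-(u * v : R)) * S.w v := by
    rw [← S.y_add, hS.w_mul_y]
    congr 2
    grind
  have h5 : S.y (↑u⁻¹ : R) * S.y (↑v⁻¹ : R) = S.y (-(↑(-(u * v))⁻¹ : R)) := by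
    rw [← S.y_add]
    congr 1
    rw [inv_neg, mul_inv]
    push_cast
    grind
  rw [h1, h2 u, h2 v]
  calc _ = (S.y (-1) * S.y (↑u⁻¹ : R) * S.w u) * (S.y (↑u⁻¹ : R) * S.y (↑v⁻¹ : R)) *
        (S.w v * (S.y (↑v⁻¹ : R) * S.y (-1))) := by simp only [mul_assoc]
    _ = _ := by
      rw [h3, h4, h5]
      nth_rw 4 [w]
      push_cast
      simp only [mul_assoc]

theorem h_mul_of_add_eq_one {u v : Rˣ} (huv : (u : R) + v = 1) : S.h u * S.h v = S.h (u * v) := by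
  have h1 := hS.w_one_eq huv
  rw [S.w_neg, S.w_eq_h_mul u, S.w_eq_h_mul v, S.w_eq_h_mul (u * v)] at h1
  have h2 : S.h u * (S.h (u * v))⁻¹ * S.h v = 1 := by
    have : S.h u * (S.h (u * v))⁻¹ * S.h v = (S.h u * S.w 1 * (S.h (u * v) * S.w 1)⁻¹ *
      (S.h v * S.w 1)) * (S.w 1)⁻¹ := by group
    rw [this, ← h1, mul_inv_cancel]
  have h3 := hS.h_comm (u * v) v
  have h4 : (S.h (u * v))⁻¹ * S.h v = S.h v * (S.h (u * v))⁻¹ := by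
    rw [inv_mul_eq_iff_eq_mul, ← mul_assoc, h3, mul_inv_cancel_right]
  rw [mul_assoc, h4, ← mul_assoc, mul_inv_eq_one] at h2
  exact h2

omit hS in
theorem isSquare_mul_of_isCyclic {G : Type*} [CommGroup G] [IsCyclic G] {a b : G}
    (ha : ¬ IsSquare a) (hb : ¬ IsSquare b) : IsSquare (a * b) := by
  obtain ⟨t, ht⟩ := IsCyclic.exists_generator (α := G)
  obtain ⟨i, rfl⟩ := Subgroup.mem_zpowers_iff.1 (ht a)
  obtain ⟨j, rfl⟩ := Subgroup.mem_zpowers_iff.1 (ht b)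
  have hodd : ∀ k : ℤ, ¬ IsSquare (t ^ k) → Odd k := by
    intro k hk
    by_contra h
    rw [Int.not_odd_iff_even] at h
    exact hk (h.isSquare_zpow t)
  rw [← _root_.zpow_add]
  exact ((hodd i ha).add_odd (hodd j hb)).isSquare_zpow t

variable [IsOddResidueRing R]

theorem h_mul (u v : Rˣ) : S.h u * S.h v = S.h (u * v) := by
  have hcyc := IsOddResidueRing.isCyclic_units (R := R)
  by_cases hu : IsSquare u
  · obtain ⟨a, rfl⟩ := hu
    rw [← pow_two, hS.h_sq_mul]
  by_cases hv : IsSquare v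
  · obtain ⟨a, rfl⟩ := hv
    rw [hS.h_comm, mul_comm u, ← pow_two, hS.h_sq_mul]
  obtain ⟨u₀, v₀, hu₀, hv₀, h0⟩ := IsOddResidueRing.exists_nonsquare (R := R)
  have key : ∀ {a b : Rˣ}, ¬ IsSquare a → ¬ IsSquare b → ∃ c, b = c ^ 2 * a := by
    intro a b ha hb
    obtain ⟨c, hc⟩ := isSquare_mul_of_isCyclic ha hb
    refine ⟨c * a⁻¹, ?_⟩
    rw [mul_pow, pow_two, ← hc, pow_two]
    rw [mul_assoc, mul_assoc a⁻¹, inv_mul_cancel, mul_one, mul_comm a, mul_inv_cancel_right]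
  obtain ⟨a, rfl⟩ := key hu₀ hu
  obtain ⟨b, rfl⟩ := key hv₀ hv
  have h1 : a ^ 2 * u₀ * (b ^ 2 * v₀) = a ^ 2 * (b ^ 2 * (u₀ * v₀)) := by ac_rfl
  rw [h1, hS.h_sq_mul, hS.h_sq_mul, hS.h_sq_mul, hS.h_sq_mul, ← hS.h_mul_of_add_eq_one h0,
    mul_assoc, ← mul_assoc (S.h u₀), hS.h_comm u₀, mul_assoc]

theorem h_inv (u : Rˣ) : S.h u⁻¹ = (S.h u)⁻¹ := by
  rw [eq_inv_iff_mul_eq_one, hS.h_mul, inv_mul_cancel, S.h_one]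

theorem h_mul_w' (u v : Rˣ) : S.h v * S.w u = S.w (v * u) := by
  rw [S.w_eq_h_mul u, ← mul_assoc, hS.h_mul, ← S.w_eq_h_mul]

theorem w_mul_w (u v : Rˣ) : S.w u * S.w (-v⁻¹) = S.h (u * v) := by
  rw [S.w_neg, S.w_eq_h_mul u, S.w_eq_h_mul v⁻¹, _root_.mul_inv_rev, mul_assoc, mul_inv_cancel_left,
    ← hS.h_inv, inv_inv, hS.h_mul]

theorem w_mul_h (u v : Rˣ) : S.w u * S.h v = S.w (u * v⁻¹) := by
  have h1 := hS.w_mul_w (u * v⁻¹ * v⁻¹) (v ^ 2)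
  have h2 : S.w u * S.h v = S.h (v ^ 2)⁻¹ * S.h v * S.w u := by
    rw [mul_assoc, hS.h_mul_w, ← mul_assoc, hS.h_mul_w', inv_mul_cancel_left]
  rw [h2, hS.h_mul, hS.h_mul_w']
  congr 1
  rw [mul_comm u]
  congr 1
  group

theorem y_eq (v : Rˣ) : S.y v = S.x (↑v⁻¹ : R) * S.w (-v⁻¹) * S.x (↑v⁻¹ : R) := by
  rw [w, ← mul_assoc, ← mul_assoc]
  simp [← S.x_add, mul_assoc, S.x_zero]

/-- The exchange relation between the two root subgroups. -/
theorem x_mul_y (r v : Rˣ) {s : R} (hs : 1 + r * s = v) :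
    S.x r * S.y s = S.y (s * (↑v⁻¹ : R)) * S.h v * S.x (r * (↑v⁻¹ : R)) := by
  have hr := Units.mul_inv r
  have hv := Units.mul_inv v
  have h1 : S.x r = S.y (↑r⁻¹ : R) * S.w r * S.y (↑r⁻¹ : R) := by
    rw [hS.w_eq, y_neg]
    group
  have h2 : (↑r⁻¹ : R) + s = ↑(r⁻¹ * v) := by
    push_cast
    grind
  have h3 : S.w r * S.w (-(r⁻¹ * v)⁻¹) = S.h v := by
    rw [hS.w_mul_w, mul_inv_cancel_left]
  rw [h1, mul_assoc, ← S.y_add, h2, hS.y_eq (r⁻¹ * v), ← mul_assoc, ← mul_assoc, mul_assoc _ (S.w r),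
    hS.w_mul_x, ← mul_assoc, ← S.y_add, mul_assoc _ (S.w r), h3]
  congr 3
  · simp only [mul_inv, inv_inv]
    push_cast
    grind
  · simp only [mul_inv, inv_inv]
    push_cast
    ring

/-- Normal forms in the group generated by the two root subgroups. -/
def IsNormalForm (S : RootPair R E) (ε : E) : Prop :=
  (∃ a u b, ε = S.x a * S.w u * S.x b) ∨ ∃ s u b, ¬ IsUnit s ∧ ε = S.y s * S.h u * S.x b

omit hS in
theorem isNormalForm_one : IsNormalForm S 1 :=
  .inr ⟨0, 1, 0, not_isUnit_zero, by simp [S.y_zero, S.h_one, S.x_zero]⟩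

theorem isNormalForm_unit_x_mul {ε : E} (hε : IsNormalForm S ε) (r : Rˣ) :
    IsNormalForm S (S.x r * ε) := by
  rcases hε with ⟨a, u, b, rfl⟩ | ⟨s, u, b, hs, rfl⟩
  · exact .inl ⟨r + a, u, b, by simp only [S.x_add, mul_assoc]⟩
  · obtain ⟨v, hv⟩ : IsUnit (1 + r * s) := isUnit_add_of_not isUnit_one (by simpa using hs)
    refine .inr ⟨s * (↑v⁻¹ : R), v * u, (↑u⁻¹ : R) ^ 2 * (r * (↑v⁻¹ : R)) + b, by simpa using hs, ?_⟩
    rw [← mul_assoc, ← mul_assoc, hS.x_mul_y r v hv.symm, mul_assoc _ (S.x _), hS.x_mul_h, S.x_add,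
      ← hS.h_mul]
    simp only [mul_assoc]

theorem isNormalForm_x_mul {ε : E} (hε : IsNormalForm S ε) (r : R) :
    IsNormalForm S (S.x r * ε) := by
  by_cases hr : IsUnit r
  · obtain ⟨r, rfl⟩ := hr
    exact hS.isNormalForm_unit_x_mul hε r
  · obtain ⟨b, hb⟩ : IsUnit (r - 1) := isUnit_sub_of_not_left hr isUnit_one
    have := hS.isNormalForm_unit_x_mul (hS.isNormalForm_unit_x_mul hε 1) b
    rwa [← mul_assoc, ← S.x_add, hb, Units.val_one, sub_add_cancel] at this

theorem isNormalForm_w_mul {ε : E} (hε : IsNormalForm S ε) (t : Rˣ) :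
    IsNormalForm S (S.w t * ε) := by
  rcases hε with ⟨a, u, b, rfl⟩ | ⟨s, u, b, hs, rfl⟩
  · have h1 : S.w t * S.w u = S.h (-(t * u⁻¹)) := by
      have := hS.w_mul_w t (-u⁻¹)
      rw [inv_neg, neg_neg, inv_inv] at this
      rw [this, mul_neg]
    rw [← mul_assoc, ← mul_assoc, hS.w_mul_x, mul_assoc (S.y _), h1]
    by_cases ha : IsUnit a
    · obtain ⟨a, rfl⟩ := ha
      refine .inl ⟨?_, ?_, ?_, ?_⟩
      rotate_right
      · have h2 : -((↑t⁻¹ : R) ^ 2 * a) = ↑(-(t⁻¹ ^ 2 * a)) := by push_cast; rfl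
        rw [h2, hS.y_eq, mul_assoc _ (S.x _), hS.x_mul_h, ← mul_assoc, mul_assoc _ (S.w _),
          hS.w_mul_h, mul_assoc _ (S.x _), ← S.x_add]
    · exact .inr ⟨_, _, b, by simpa using ha, rfl⟩
  · refine .inl ⟨-((t : R) ^ 2 * s), t * u⁻¹, b, ?_⟩
    rw [← mul_assoc, ← mul_assoc, hS.w_mul_y, mul_assoc (S.x _), hS.w_mul_h]

theorem isNormalForm_of_mem {ε : E}
    (hε : ε ∈ Subgroup.closure (Set.range S.x ∪ Set.range S.w)) : IsNormalForm S ε := by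
  induction hε using Subgroup.closure_induction_left with
  | one => exact isNormalForm_one
  | mul_left η hη ε _ ih =>
    rcases hη with ⟨a, rfl⟩ | ⟨u, rfl⟩
    · exact hS.isNormalForm_x_mul ih a
    · exact hS.isNormalForm_w_mul ih u
  | inv_mul_cancel η hη ε _ ih =>
    rcases hη with ⟨a, rfl⟩ | ⟨u, rfl⟩
    · rw [← S.x_neg]
      exact hS.isNormalForm_x_mul ih _
    · rw [← S.w_neg]
      exact hS.isNormalForm_w_mul ih _

end IsWeyl
end RootPair
end Symp

namespace Symp

section CentralExtension

variable {E Q : Type*} [Group E] [Group Q] {π : E →* Q}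

theorem exists_center_mul (hker : π.ker ≤ Subgroup.center E) {ε η : E} (h : π ε = π η) :
    ∃ z ∈ Subgroup.center E, ε = η * z :=
  ⟨η⁻¹ * ε, hker (by simp [MonoidHom.mem_ker, h]), by simp⟩

theorem commute_of_map_eq (hker : π.ker ≤ Subgroup.center E) {ε η c : E} (h : π ε = π η)
    (hc : Commute η c) : Commute ε c := by
  obtain ⟨z, hz, rfl⟩ := exists_center_mul hker h
  exact hc.mul_left (Subgroup.mem_center_iff.1 hz c).symm

theorem conj_eq_of_map_eq (hker : π.ker ≤ Subgroup.center E) {ε η : E} (h : π ε = π η) (c : E) :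
    ε * c * ε⁻¹ = η * c * η⁻¹ := by
  obtain ⟨z, hz, rfl⟩ := exists_center_mul hker h
  have := Subgroup.mem_center_iff.1 hz c
  rw [_root_.mul_inv_rev, mul_assoc η, ← this]
  group

/-- Lifts of the elements of a cyclic group to a central extension commute. -/
theorem commute_of_isCyclic (hker : π.ker ≤ Subgroup.center E) {G : Type*} [Group G] [IsCyclic G]
    (φ : G → E) (hφ : ∀ a b, π (φ (a * b)) = π (φ a) * π (φ b)) (a b : G) :
    Commute (φ a) (φ b) := by
  obtain ⟨t, ht⟩ := IsCyclic.exists_generator (α := G)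
  have key : ∀ (c : E), Commute (φ t) c → ∀ a, Commute (φ a) c := by
    intro c hc a
    let ψ : G →* Q := MonoidHom.mk' (fun a => π (φ a)) hφ
    have hle : Subgroup.zpowers t ≤ ((Subgroup.centralizer {c}).map π).comap ψ := by
      rw [Subgroup.zpowers_le]
      exact ⟨φ t, Subgroup.mem_centralizer_singleton_iff.2 hc, rfl⟩
    obtain ⟨d, hd, hd'⟩ := hle (ht a)
    exact commute_of_map_eq hker hd'.symm (Subgroup.mem_centralizer_singleton_iff.1 hd)
  exact key _ (key _ (Commute.refl _) b).symm a

end CentralExtension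

variable {R V : Type*} [CommRing R] [AddCommGroup V] [Module R V]
variable {ω : V →ₗ[R] V →ₗ[R] R} [hω : Fact ω.IsAlt]
variable {E : Type*} [Group E] {π : E →* Sp ω}

namespace HeisLift

variable (L : HeisLift π) {e f : V}

/-- The root subgroups attached to a hyperbolic pair. -/
def rootPair (he : Uni ω e) (hf : Uni ω f) : RootPair R E where
  x a := L.τ e a
  y b := L.τ f (-b)
  x_add := L.τ_add he
  y_add a b := by rw [neg_add, L.τ_add hf]

section

variable (hef : ω e f = 1) (he : Uni ω e) (hf : Uni ω f)
include hef

theorem rootPair_x_smul_e (a : R) : π ((L.rootPair he hf).x a) • e = e := by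
  change π (L.τ e a) • e = e
  simp [L.τ_smul he]

theorem rootPair_x_smul_f (a : R) : π ((L.rootPair he hf).x a) • f = f + a • e := by
  change π (L.τ e a) • f = _
  simp [L.τ_smul he, hef]

theorem rootPair_y_smul_e (b : R) : π ((L.rootPair he hf).y b) • e = e + b • f := by
  change π (L.τ f (-b)) • e = _
  simp [L.τ_smul hf, form_swap f e, hef]

theorem rootPair_y_smul_f (b : R) : π ((L.rootPair he hf).y b) • f = f := by
  change π (L.τ f (-b)) • f = _
  simp [L.τ_smul hf]

theorem rootPair_w_smul_e (u : Rˣ) :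
    π ((L.rootPair he hf).w u) • e = -((↑u⁻¹ : R) • f) := by
  rw [RootPair.w, map_mul, map_mul, mul_smul, mul_smul, L.rootPair_x_smul_e hef,
    L.rootPair_y_smul_e hef, smul_add, Sp.smul_smul_comm, L.rootPair_x_smul_e hef,
    L.rootPair_x_smul_f hef]
  have := Units.inv_mul u
  match_scalars <;> grind

theorem rootPair_w_smul_f (u : Rˣ) : π ((L.rootPair he hf).w u) • f = (u : R) • e := by
  rw [RootPair.w, map_mul, map_mul, mul_smul, mul_smul, L.rootPair_x_smul_f hef, smul_add,
    Sp.smul_smul_comm, L.rootPair_y_smul_f hef, L.rootPair_y_smul_e hef]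
  simp only [smul_add, Sp.smul_smul_comm, L.rootPair_x_smul_f hef, L.rootPair_x_smul_e hef]
  have := Units.mul_inv u
  match_scalars <;> grind

theorem rootPair_h_smul_e (u : Rˣ) : π ((L.rootPair he hf).h u) • e = (u : R) • e := by
  rw [RootPair.h, map_mul, map_inv, mul_smul]
  have : (π ((L.rootPair he hf).w 1))⁻¹ • e = f := by
    rw [inv_smul_eq_iff, L.rootPair_w_smul_f hef]
    simp
  rw [this, L.rootPair_w_smul_f hef]

theorem rootPair_h_smul_f (u : Rˣ) : π ((L.rootPair he hf).h u) • f = (↑u⁻¹ : R) • f := by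
  rw [RootPair.h, map_mul, map_inv, mul_smul]
  have : (π ((L.rootPair he hf).w 1))⁻¹ • f = -e := by
    rw [inv_smul_eq_iff, smul_neg, L.rootPair_w_smul_e hef]
    simp
  rw [this, smul_neg, L.rootPair_w_smul_e hef, neg_neg]

end

variable {U : Submodule R V} (hef : ω e f = 1) (heU : e ∈ U) (hfU : f ∈ U)
  (hU : ∀ x ∈ U, x = ω x f • e + ω e x • f)
include hef hU

theorem map_eq_of_plane {ε η : E} (hε : ε ∈ L.elem U) (hη : η ∈ L.elem U)
    (h1 : π ε • e = π η • e) (h2 : π ε • f = π η • f) : π ε = π η := by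
  apply Sp.ext
  intro x
  have hx : ∀ u ∈ U, ω u (x - (ω x f • e + ω e x • f)) = 0 := by
    intro u hu
    have h1 := form_swap (ω := ω) x f
    rw [hU u hu]
    simp only [map_add, map_sub, map_smul, LinearMap.add_apply, LinearMap.smul_apply, smul_eq_mul,
      form_self, hef, form_swap f e, h1]
    ring
  have h3 := L.elem_smul_eq hε hx
  have h4 := L.elem_smul_eq hη hx
  simp only [smul_sub, smul_add, Sp.smul_smul_comm, h1, h2] at h3 h4
  have := h3.trans h4.symm
  simpa using this

variable [IsOddResidueRing R]
include heU hfU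

theorem isWeyl_rootPair (hker : π.ker ≤ Subgroup.center E) (he : Uni ω e) (hf : Uni ω f) :
    (L.rootPair he hf).IsWeyl := by
  have hx : ∀ a, (L.rootPair he hf).x a ∈ L.elem U := fun a => L.τ_mem heU he a
  have hy : ∀ a, (L.rootPair he hf).y a ∈ L.elem U := fun a => L.τ_mem hfU hf _
  have hw : ∀ u, (L.rootPair he hf).w u ∈ L.elem U := fun u =>
    mul_mem (mul_mem (hx _) (hy _)) (hx _)
  have hh : ∀ u, (L.rootPair he hf).h u ∈ L.elem U := fun u => mul_mem (hw _) (inv_mem (hw _))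
  constructor
  · intro u a
    change _ * L.τ e a * _ = L.τ f _
    rw [L.τ_conj he, L.rootPair_w_smul_e hef]
    have := L.τ_scale hf a (-u⁻¹)
    simpa using this
  · intro u a
    change _ * L.τ f _ * _ = L.τ e _
    rw [L.τ_conj hf, L.rootPair_w_smul_f hef, L.τ_scale he]
    simp
  · have := IsOddResidueRing.isCyclic_units (R := R)
    intro u v
    refine commute_of_isCyclic hker _ ?_ u v
    intro u v
    rw [← map_mul]
    apply L.map_eq_of_plane hef hU (hh _) (mul_mem (hh _) (hh _))
    · rw [map_mul, mul_smul]
      simp only [L.rootPair_h_smul_e hef, Sp.smul_smul_comm, smul_smul]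
      push_cast
      rw [mul_comm]
    · rw [map_mul, mul_smul]
      simp only [L.rootPair_h_smul_f hef, Sp.smul_smul_comm, smul_smul, mul_inv]
      push_cast
      rw [mul_comm]

theorem elem_le_closure_rootPair (hker : π.ker ≤ Subgroup.center E) (he : Uni ω e)
    (hf : Uni ω f) : L.elem U ≤ Subgroup.closure
      (Set.range (L.rootPair he hf).x ∪ Set.range (L.rootPair he hf).w) := by
  set S := L.rootPair he hf with hSdef
  have hS : S.IsWeyl := L.isWeyl_rootPair hef heU hfU hU hker he hf
  set K := Subgroup.closure (Set.range S.x ∪ Set.range S.w) with hK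
  have hx : ∀ a, S.x a ∈ K := fun a => Subgroup.subset_closure (.inl ⟨a, rfl⟩)
  have hw : ∀ a, S.w a ∈ K := fun a => Subgroup.subset_closure (.inr ⟨a, rfl⟩)
  have hy : ∀ a, S.y a ∈ K := by
    intro a
    have := hS.w_x 1 (-a)
    simp only [inv_one, Units.val_one, one_pow, one_mul, neg_neg] at this
    rw [← this]
    exact mul_mem (mul_mem (hw _) (hx _)) (inv_mem (hw _))
  refine (Subgroup.closure_le _).2 ?_
  rintro _ ⟨u, hu, ⟨y, huy⟩, a, rfl⟩
  have hu' := hU u hu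
  generalize ω u f = α at hu'
  generalize ω e u = β at hu'
  have h1 : IsUnit (α * ω e y + β * ω f y) := by
    rw [hu'] at huy
    simp at huy
    simp [huy]
  rcases IsLocalRing.isUnit_or_isUnit_of_isUnit_add h1 with h | h
  · obtain ⟨α, rfl⟩ := isUnit_of_mul_isUnit_left h
    have h2 : u = (α : R) • π (S.y (↑α⁻¹ * β)) • e := by
      rw [hSdef, L.rootPair_y_smul_e hef, hu']
      have := Units.mul_inv α
      match_scalars <;> grind
    rw [h2, L.τ_scale (he.smul _), ← L.τ_conj he]
    exact mul_mem (mul_mem (hy _) (hx _)) (inv_mem (hy _))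
  · obtain ⟨β, rfl⟩ := isUnit_of_mul_isUnit_left h
    have h2 : u = (β : R) • π (S.x (↑β⁻¹ * α)) • f := by
      rw [hSdef, L.rootPair_x_smul_f hef, hu']
      have := Units.mul_inv β
      match_scalars <;> grind
    have h3 : L.τ f ((β : R) ^ 2 * a) ∈ K := by
      have := hy (-((β : R) ^ 2 * a))
      change L.τ f (- -((β : R) ^ 2 * a)) ∈ K at this
      rwa [neg_neg] at this
    rw [h2, L.τ_scale (hf.smul _), ← L.τ_conj hf]
    exact mul_mem (mul_mem (hx _) h3) (inv_mem (hx _))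

theorem faithful_plane (hker : π.ker ≤ Subgroup.center E) : L.Faithful U := by
  have he : Uni ω e := ⟨f, hef⟩
  have hf : Uni ω f := ⟨-e, by simp [form_swap f e, hef]⟩
  intro ε hε h1
  have hS := L.isWeyl_rootPair hef heU hfU hU hker he hf
  rcases hS.isNormalForm_of_mem (L.elem_le_closure_rootPair hef heU hfU hU hker he hf hε) with
    ⟨a, u, b, rfl⟩ | ⟨s, u, b, -, rfl⟩
  · exfalso
    have h2 := congrArg (fun M : Sp ω => ω e (M • e)) h1
    simp only [map_mul, mul_smul, L.rootPair_x_smul_e hef, L.rootPair_w_smul_e hef, smul_neg,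
      Sp.smul_smul_comm, L.rootPair_x_smul_f hef, map_neg, map_smul, map_add, hef, form_self,
      one_smul] at h2
    simp at h2
  · have h2 := congrArg (fun M : Sp ω => ω e (M • e)) h1
    have h3 := congrArg (fun M : Sp ω => ω (M • e) f) h1
    simp only [map_mul, mul_smul, L.rootPair_x_smul_e hef, L.rootPair_h_smul_e hef,
      Sp.smul_smul_comm, L.rootPair_y_smul_e hef, map_smul, map_add, hef, form_self,
      one_smul, LinearMap.add_apply, LinearMap.smul_apply] at h2 h3
    simp at h2 h3
    subst h2 h3
    have h4 := congrArg (fun M : Sp ω => ω (M • f) f) h1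
    simp only [RootPair.y_zero, RootPair.h_one, one_mul, L.rootPair_x_smul_f hef, map_add,
      map_smul, LinearMap.add_apply, LinearMap.smul_apply, hef, form_self, one_smul] at h4
    simp at h4
    rw [h4, RootPair.y_zero, RootPair.h_one, RootPair.x_zero]
    simp

end HeisLift

end Symp

namespace Symp

open scoped commutatorElement

section Half

variable (R : Type*) [CommRing R] [IsOddResidueRing R]

/-- The inverse of `2`. -/
noncomputable def half : R := ↑(IsOddResidueRing.isUnit_two (R := R)).unit⁻¹

theorem two_mul_half : 2 * half R = 1 :=
  (IsOddResidueRing.isUnit_two (R := R)).mul_val_inv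

end Half

variable {R V : Type*} [CommRing R] [AddCommGroup V] [Module R V]

/-- A symplectic basis of `V`, given by the first `g` terms of two sequences. -/
structure IsSympBasis (ω : V →ₗ[R] V →ₗ[R] R) (g : ℕ) (e f : ℕ → V) : Prop where
  form_ef {i : ℕ} : i < g → ω (e i) (f i) = 1
  form_ef_ne {i j : ℕ} : i < g → j < g → i ≠ j → ω (e i) (f j) = 0
  form_ee {i j : ℕ} : i < g → j < g → ω (e i) (e j) = 0
  form_ff {i j : ℕ} : i < g → j < g → ω (f i) (f j) = 0
  eq_sum (x : V) : x = ∑ i ∈ Finset.range g, (ω x (f i) • e i + ω (e i) x • f i)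

variable {ω : V →ₗ[R] V →ₗ[R] R} [hω : Fact ω.IsAlt]

section PlaneNeg

variable {a b : V} (h : ω a b = 1)

/-- The linear map negating the plane spanned by `a` and `b`. -/
def planeNegLin (ω : V →ₗ[R] V →ₗ[R] R) (a b : V) : V →ₗ[R] V :=
  LinearMap.id + ((2 : R) • ω b).smulRight a - ((2 : R) • ω a).smulRight b

omit hω in
theorem planeNegLin_apply (x : V) :
    planeNegLin ω a b x = x + (2 * ω b x) • a - (2 * ω a x) • b := by
  simp [planeNegLin]

include h in
theorem involutive_planeNegLin : Function.Involutive (planeNegLin ω a b) := by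
  intro x
  simp only [planeNegLin_apply, map_add, map_sub, map_smul, form_self, h, form_swap b a,
    smul_eq_mul]
  module

/-- The isometry negating the hyperbolic plane spanned by `a` and `b`. -/
noncomputable def planeNeg : Sp ω :=
  ⟨LinearEquiv.ofInvolutive (planeNegLin ω a b) (involutive_planeNegLin h), by
    intro x y
    change ω (planeNegLin ω a b x) (planeNegLin ω a b y) = ω x y
    have h1 := form_swap (ω := ω) x a
    have h2 := form_swap (ω := ω) x b
    simp only [planeNegLin_apply, map_add, map_sub, map_smul,
      LinearMap.add_apply, LinearMap.sub_apply, LinearMap.smul_apply, form_self, h,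
      form_swap b a, smul_eq_mul, h1, h2]
    ring⟩

theorem planeNeg_smul (x : V) :
    planeNeg h • x = x + (2 * ω b x) • a - (2 * ω a x) • b := by
  rw [← planeNegLin_apply]
  rfl

theorem planeNeg_smul_left : planeNeg h • a = -a := by
  rw [planeNeg_smul, form_swap b a, h]
  simp
  module

theorem planeNeg_smul_of_form_eq_zero {x : V} (h1 : ω a x = 0) (h2 : ω b x = 0) :
    planeNeg h • x = x := by
  simp [planeNeg_smul, h1, h2]

theorem planeNeg_mul_self : planeNeg h * planeNeg h = 1 := by
  apply Sp.ext
  intro x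
  rw [mul_smul, planeNeg_smul, planeNeg_smul]
  simp only [map_add, map_sub, map_smul, form_self, h, form_swap b a, smul_eq_mul, one_smul]
  module

theorem planeNeg_conj (M : Sp ω) (c : Rˣ) (ha : M • a = (c : R) • a)
    (hb : M • b = (↑c⁻¹ : R) • b) : M * planeNeg h * M⁻¹ = planeNeg h := by
  apply Sp.ext
  intro x
  have h1 : M⁻¹ • a = (↑c⁻¹ : R) • a := by
    rw [inv_smul_eq_iff, Sp.smul_smul_comm, ha, smul_smul]
    simp
  have h2 : M⁻¹ • b = (c : R) • b := by
    rw [inv_smul_eq_iff, Sp.smul_smul_comm, hb, smul_smul]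
    simp
  rw [mul_smul, mul_smul, planeNeg_smul, planeNeg_smul]
  simp only [smul_add, smul_sub, Sp.smul_smul_comm, smul_inv_smul, ha, hb, form_smul_right,
    inv_inv, h1, h2, map_smul, LinearMap.smul_apply, smul_eq_mul]
  have := Units.mul_inv c
  match_scalars <;> grind

end PlaneNeg

theorem heis_commutator {v w w' : V} (hw : ω v w = 0) (hw' : ω v w' = 0) (a b : R) :
    ⁅heis ω v w a, heis ω v w' b⁆ = transv ω v (2 * ω w w') := by
  rw [commutatorElement_def, mul_inv_eq_iff_eq_mul, mul_inv_eq_iff_eq_mul, heis_mul hw hw',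
    heis_mul (map_zero _) hw', heis_mul (by simpa using hw') hw]
  simp only [zero_add, map_zero, LinearMap.zero_apply, add_comm w', form_swap w' w]
  ring_nf

theorem heis_mul_transv {v w : V} (hw : ω v w = 0) (a b : R) :
    heis ω v w a * transv ω v b = heis ω v w (a + b) := by
  rw [heis_mul hw (map_zero _)]
  simp

theorem heis_smul_add_smul {v w : V} (hw : ω v w = 0) (c a : R) :
    heis ω v (w + c • v) a = heis ω v w (a + 2 * c) := by
  apply Sp.ext
  intro x
  rw [heis_smul hw, heis_smul (by simp [hw])]
  simp only [map_add, map_smul, LinearMap.add_apply, LinearMap.smul_apply, smul_eq_mul]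
  module

/-- A central extension of the symplectic group of a module with a symplectic basis. -/
structure CentralExt {E : Type*} [Group E] (π : E →* Sp ω) (g : ℕ) where
  /-- The first half of the basis. -/
  e : ℕ → V
  /-- The second half of the basis. -/
  f : ℕ → V
  ker_le : π.ker ≤ Subgroup.center E
  surj : Function.Surjective π
  basis : IsSympBasis ω g e f
  two_le : 2 ≤ g

namespace CentralExt

variable {E : Type*} [Group E] {π : E →* Sp ω} {g : ℕ} (D : CentralExt π g)

/-- The orthogonal complement of the first hyperbolic plane. -/
def W : Submodule R V := LinearMap.ker (ω (D.e 0)) ⊓ LinearMap.ker (ω (D.f 0))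

theorem mem_W {w : V} : w ∈ D.W ↔ ω (D.e 0) w = 0 ∧ ω (D.f 0) w = 0 := by simp [W]

theorem form_e_f : ω (D.e 0) (D.f 0) = 1 := D.basis.form_ef (by have := D.two_le; omega)

theorem e_mem_W {i : ℕ} (h0 : i ≠ 0) (hi : i < g) : D.e i ∈ D.W := by
  have := D.two_le
  rw [mem_W, form_swap (D.f 0)]
  exact ⟨D.basis.form_ee (by omega) hi, by rw [D.basis.form_ef_ne hi (by omega) h0, neg_zero]⟩

theorem f_mem_W {i : ℕ} (h0 : i ≠ 0) (hi : i < g) : D.f i ∈ D.W := by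
  have := D.two_le
  rw [mem_W]
  exact ⟨D.basis.form_ef_ne (by omega) hi (Ne.symm h0), D.basis.form_ff (by omega) hi⟩

/-- A lift of an element of the symplectic group. -/
noncomputable def lift (M : Sp ω) : E := Function.surjInv D.surj M

@[simp] theorem map_lift (M : Sp ω) : π (D.lift M) = M := Function.surjInv_eq D.surj M

include D in
theorem mem_center {ε : E} (h : π ε = 1) : ε ∈ Subgroup.center E := D.ker_le h

include D in
theorem commute_of_map_eq_one {ε : E} (h : π ε = 1) (η : E) : Commute ε η :=
  (Subgroup.mem_center_iff.1 (D.mem_center h) η).symm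

include D in
/-- If `ζ` commutes up to central elements with `ε` and `η`, then it commutes with their
commutator. -/
theorem commute_commutator {ε η ζ : E} (hε : Commute (π ε) (π ζ)) (hη : Commute (π η) (π ζ)) :
    Commute ⁅ε, η⁆ ζ := by
  obtain ⟨c, hc, h1⟩ := exists_center_mul D.ker_le (ε := ζ * ε * ζ⁻¹) (η := ε)
    (by rw [map_mul, map_mul, map_inv, ← hε.eq, mul_inv_cancel_right])
  obtain ⟨d, hd, h2⟩ := exists_center_mul D.ker_le (ε := ζ * η * ζ⁻¹) (η := η)
    (by rw [map_mul, map_mul, map_inv, ← hη.eq, mul_inv_cancel_right])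
  have h3 : ζ * ⁅ε, η⁆ * ζ⁻¹ = ⁅ε, η⁆ := by
    have h4 : ζ * ⁅ε, η⁆ * ζ⁻¹ = ⁅ζ * ε * ζ⁻¹, ζ * η * ζ⁻¹⁆ := by
      simp only [commutatorElement_def]
      group
    rw [h4, h1, h2, commutatorElement_def, commutatorElement_def]
    have hc' := fun x => Subgroup.mem_center_iff.1 hc x
    have hd' := fun x => Subgroup.mem_center_iff.1 hd x
    calc ε * c * (η * d) * (ε * c)⁻¹ * (η * d)⁻¹
        = ε * (c * η) * (d * c⁻¹) * ε⁻¹ * d⁻¹ * η⁻¹ := by group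
      _ = ε * η * (c * d * c⁻¹) * ε⁻¹ * d⁻¹ * η⁻¹ := by rw [← hc' η]; group
      _ = ε * η * (d * ε⁻¹) * d⁻¹ * η⁻¹ := by rw [hd' c]; group
      _ = ε * η * ε⁻¹ * η⁻¹ := by rw [← hd' ε⁻¹]; group
  exact (mul_inv_eq_iff_eq_mul.1 h3).symm

variable [IsOddResidueRing R]

/-- Lifts of transvections along `e 0` commute with lifts of the element negating the plane. -/
theorem commute_planeNeg {ζ m : E} {a : R} (hζ : π ζ = transv ω (D.e 0) a)
    (hm : π m = planeNeg D.form_e_f) : Commute ζ m := by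
  set ξ := D.lift (transv ω (D.e 0) (half R * a))
  have h2 := two_mul_half R
  have hξ : π ξ = transv ω (D.e 0) (half R * a) := D.map_lift _
  have hconj : ∀ b : R, π m * transv ω (D.e 0) b * (π m)⁻¹ = transv ω (D.e 0) b := by
    intro b
    have := heis_scale (-1 : Rˣ) (D.e 0) (0 : V) b (ω := ω)
    simp only [Units.val_neg, Units.val_one, neg_smul, one_smul, smul_zero, neg_zero] at this
    rw [heis_conj, hm, planeNeg_smul_left, smul_zero, this]
    ring_nf
  obtain ⟨d, hd, h1⟩ := exists_center_mul D.ker_le (ε := m * ξ * m⁻¹) (η := ξ)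
    (by rw [map_mul, map_mul, map_inv, hξ, hconj])
  have hd' := fun x => Subgroup.mem_center_iff.1 hd x
  have hmm : Commute (m * m) ξ := D.commute_of_map_eq_one (by simp [hm, planeNeg_mul_self]) _
  have h3 : ξ = ξ * (d * d) := by
    calc ξ = m * m * ξ * (m * m)⁻¹ := by rw [hmm.eq, mul_inv_cancel_right]
      _ = m * (m * ξ * m⁻¹) * m⁻¹ := by group
      _ = m * ξ * (d * m⁻¹) := by rw [h1]; group
      _ = m * ξ * m⁻¹ * d := by rw [← hd' m⁻¹]; group
      _ = _ := by rw [h1]; group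
  have h4 : d * d = 1 := by simpa using h3
  refine commute_of_map_eq D.ker_le (η := ξ * ξ) ?_ ?_
  · rw [map_mul, hξ, heis_mul_transv (map_zero _), hζ]
    congr 1
    linear_combination -a * h2
  · have h5 : m * (ξ * ξ) * m⁻¹ = ξ * ξ := by
      calc m * (ξ * ξ) * m⁻¹ = (m * ξ * m⁻¹) * (m * ξ * m⁻¹) := by group
        _ = ξ * (d * ξ) * d := by rw [h1]; group
        _ = ξ * ξ * (d * d) := by rw [← hd' ξ]; group
        _ = _ := by rw [h4, mul_one]
    exact (mul_inv_eq_iff_eq_mul.1 h5).symm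

theorem planeNeg_conj_heis {w : V} (hw : w ∈ D.W) (a : R) :
    planeNeg D.form_e_f * heis ω (D.e 0) w a * (planeNeg D.form_e_f)⁻¹ =
      heis ω (D.e 0) (-w) a := by
  have hw := D.mem_W.1 hw
  rw [heis_conj, planeNeg_smul_left, planeNeg_smul_of_form_eq_zero _ hw.1 hw.2]
  have := heis_scale (-1 : Rˣ) (D.e 0) w a (ω := ω)
  simpa using this

theorem commutator_planeNeg {w : V} (hw : w ∈ D.W) (a : R) :
    ⁅planeNeg D.form_e_f, heis ω (D.e 0) (-half R • w) a⁆ = heis ω (D.e 0) w 0 := by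
  have h2 := two_mul_half R
  have hw' := (D.mem_W.1 hw).1
  rw [commutatorElement_def, D.planeNeg_conj_heis (D.W.smul_mem _ hw), mul_inv_eq_iff_eq_mul,
    heis_mul hw' (by simp [hw'])]
  have h3 : ω w (-half R • w) = 0 := by simp
  rw [h3]
  congr 1
  · match_scalars
    linear_combination h2
  · ring

theorem commute_transv_heis {w : V} (hw : ω (D.e 0) w = 0) (a b : R) :
    Commute (transv ω (D.e 0) a) (heis ω (D.e 0) w b) := by
  rw [commute_iff_eq, heis_mul_transv hw, heis_mul (map_zero _) hw]
  simp [add_comm]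

/-- Lifts of transvections along `e 0` commute with lifts of Heisenberg elements. -/
theorem commute_heis_lift {ζ η : E} {a b : R} {w : V} (hw : w ∈ D.W)
    (hζ : π ζ = transv ω (D.e 0) a) (hη : π η = heis ω (D.e 0) w b) : Commute η ζ := by
  have h2 := two_mul_half R
  have key : ∀ w ∈ D.W, ∀ η, π η = heis ω (D.e 0) w 0 → Commute η ζ := by
    intro w hw η hη
    have hw' := (D.mem_W.1 hw).1
    refine commute_of_map_eq D.ker_le (η := ⁅D.lift (planeNeg D.form_e_f),
      D.lift (heis ω (D.e 0) (-half R • w) 0)⁆) ?_ (D.commute_commutator ?_ ?_)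
    · rw [map_commutatorElement, map_lift, map_lift, D.commutator_planeNeg hw, hη]
    · exact ((D.commute_planeNeg hζ (D.map_lift _)).map π).symm
    · rw [map_lift, hζ]
      exact (D.commute_transv_heis (by simp [hw']) _ _).symm
  have hg := D.two_le
  have he := D.e_mem_W one_ne_zero hg
  have hf := D.f_mem_W one_ne_zero hg
  have hc : Commute ⁅D.lift (heis ω (D.e 0) ((half R * b) • D.e 1) 0),
      D.lift (heis ω (D.e 0) (D.f 1) 0)⁆ ζ := by
    apply D.commute_commutator <;> refine Commute.map (key _ ?_ _ (D.map_lift _)) π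
    · exact D.W.smul_mem _ he
    · exact hf
  refine commute_of_map_eq D.ker_le (η := D.lift (heis ω (D.e 0) w 0) * _) ?_
    ((key w hw _ (D.map_lift _)).mul_left hc)
  rw [map_mul, map_lift, map_commutatorElement, map_lift, map_lift,
    heis_commutator (by simp [(D.mem_W.1 he).1]) (D.mem_W.1 hf).1,
    heis_mul_transv (D.mem_W.1 hw).1, hη]
  simp [D.basis.form_ef hg, ← mul_assoc, h2]

end CentralExt

end Symp

namespace Symp

open scoped commutatorElement

variable {R V : Type*} [CommRing R] [AddCommGroup V] [Module R V]
variable {ω : V →ₗ[R] V →ₗ[R] R} [hω : Fact ω.IsAlt]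

namespace CentralExt

variable {E : Type*} [Group E] {π : E →* Sp ω} {g : ℕ} (D : CentralExt π g)

/-- The commutator of lifts of two Heisenberg elements. -/
noncomputable def B (w w' : V) : E :=
  ⁅D.lift (heis ω (D.e 0) w 0), D.lift (heis ω (D.e 0) w' 0)⁆

theorem B_swap (w w' : V) : D.B w' w = (D.B w w')⁻¹ := (commutatorElement_inv _ _).symm

theorem map_B {w w' : V} (hw : w ∈ D.W) (hw' : w' ∈ D.W) :
    π (D.B w w') = transv ω (D.e 0) (2 * ω w w') := by
  rw [B, map_commutatorElement, map_lift, map_lift,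
    heis_commutator (D.mem_W.1 hw).1 (D.mem_W.1 hw').1]

theorem smul_mem_W {M : Sp ω} {c : Rˣ} (he : M • D.e 0 = (c : R) • D.e 0)
    (hf : M • D.f 0 = (↑c⁻¹ : R) • D.f 0) {w : V} (hw : w ∈ D.W) : M • w ∈ D.W := by
  have hw := D.mem_W.1 hw
  have h1 : M⁻¹ • D.e 0 = (↑c⁻¹ : R) • D.e 0 := by
    rw [inv_smul_eq_iff, Sp.smul_smul_comm, he, smul_smul]
    simp
  have h2 : M⁻¹ • D.f 0 = (c : R) • D.f 0 := by
    rw [inv_smul_eq_iff, Sp.smul_smul_comm, hf, smul_smul]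
    simp
  rw [mem_W, form_smul_right, form_smul_right, h1, h2]
  simp [hw.1, hw.2]

theorem conj_heis {M : Sp ω} {c : Rˣ} (he : M • D.e 0 = (c : R) • D.e 0) (w : V) (a : R) :
    M * heis ω (D.e 0) w a * M⁻¹ = heis ω (D.e 0) ((c : R) • M • w) (c ^ 2 * a) := by
  rw [heis_conj, he, heis_scale]

variable [IsOddResidueRing R]

theorem commute_B {w w' w'' : V} (hw : w ∈ D.W) (hw' : w' ∈ D.W) (hw'' : w'' ∈ D.W) {η : E}
    {b : R} (hη : π η = heis ω (D.e 0) w'' b) : Commute (D.B w w') η :=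
  (D.commute_heis_lift hw'' (D.map_B hw hw') hη).symm

theorem commutator_congr_left {w w' : V} (hw : w ∈ D.W) (hw' : w' ∈ D.W) {ε ε' η : E}
    {a a' b : R} (hε : π ε = heis ω (D.e 0) w a) (hε' : π ε' = heis ω (D.e 0) w a')
    (hη : π η = heis ω (D.e 0) w' b) : ⁅ε, η⁆ = ⁅ε', η⁆ := by
  have h1 : π (ε'⁻¹ * ε) = transv ω (D.e 0) (a - a') := by
    rw [map_mul, map_inv, inv_mul_eq_iff_eq_mul, hε, hε', heis_mul_transv (D.mem_W.1 hw).1,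
      add_sub_cancel]
  have h2 := D.commute_heis_lift hw' h1 hη
  have h3 : ε = ε' * (ε'⁻¹ * ε) := by group
  generalize ε'⁻¹ * ε = t at h2 h3
  subst h3
  rw [commutatorElement_def, mul_assoc ε', ← h2.eq, commutatorElement_def]
  group

theorem commutator_eq_B {w w' : V} (hw : w ∈ D.W) (hw' : w' ∈ D.W) {ε η : E}
    {a b : R} (hε : π ε = heis ω (D.e 0) w a) (hη : π η = heis ω (D.e 0) w' b) :
    ⁅ε, η⁆ = D.B w w' := by
  rw [D.commutator_congr_left hw hw' hε (D.map_lift (heis ω (D.e 0) w 0)) hη,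
    ← commutatorElement_inv,
    D.commutator_congr_left hw' hw hη (D.map_lift (heis ω (D.e 0) w' 0)) (D.map_lift _),
    commutatorElement_inv]
  rfl

theorem B_conj {ε : E} {c : Rˣ} (he : π ε • D.e 0 = (c : R) • D.e 0)
    (hf : π ε • D.f 0 = (↑c⁻¹ : R) • D.f 0) {w w' : V} (hw : w ∈ D.W) (hw' : w' ∈ D.W) :
    ε * D.B w w' * ε⁻¹ = D.B ((c : R) • π ε • w) ((c : R) • π ε • w') := by
  have h1 : ∀ x : V, π (ε * D.lift (heis ω (D.e 0) x 0) * ε⁻¹) =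
      heis ω (D.e 0) ((c : R) • π ε • x) (c ^ 2 * 0) := by
    intro x
    rw [map_mul, map_mul, map_inv, map_lift, D.conj_heis he]
  rw [← D.commutator_eq_B (D.W.smul_mem _ (D.smul_mem_W he hf hw))
    (D.W.smul_mem _ (D.smul_mem_W he hf hw')) (h1 w) (h1 w'), B]
  simp only [commutatorElement_def]
  group

theorem B_add_left {w₁ w₂ w : V} (h₁ : w₁ ∈ D.W) (h₂ : w₂ ∈ D.W) (hw : w ∈ D.W) :
    D.B (w₁ + w₂) w = D.B w₁ w * D.B w₂ w := by
  set x := D.lift (heis ω (D.e 0) w₁ 0) with hx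
  set y := D.lift (heis ω (D.e 0) w₂ 0) with hy
  set z := D.lift (heis ω (D.e 0) w 0) with hz
  have hxy : π (x * y) = heis ω (D.e 0) (w₁ + w₂) (0 + 0 + ω w₁ w₂) := by
    rw [map_mul, map_lift, map_lift, heis_mul (D.mem_W.1 h₁).1 (D.mem_W.1 h₂).1]
  have h3 : Commute (D.B w₂ w) x := D.commute_B h₂ hw h₁ (D.map_lift _)
  have h4 : Commute (D.B w₂ w) z := D.commute_B h₂ hw hw (D.map_lift _)
  rw [← D.commutator_eq_B (D.W.add_mem h₁ h₂) hw hxy (D.map_lift _)]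
  calc ⁅x * y, z⁆ = x * D.B w₂ w * z * x⁻¹ * z⁻¹ := by
        rw [B, ← hy, ← hz, commutatorElement_def, commutatorElement_def]; group
    _ = D.B w₂ w * D.B w₁ w := by
      rw [← h3.eq, B, B, ← hx, ← hz, commutatorElement_def x]; group
    _ = _ := by
      have h5 : Commute (D.B w₂ w) (D.B w₁ w) := by
        change Commute _ ⁅x, z⁆
        rw [commutatorElement_def]
        exact ((h3.mul_right h4).mul_right h3.inv_right).mul_right h4.inv_right
      exact h5.eq

theorem B_add_right {w₁ w₂ w : V} (h₁ : w₁ ∈ D.W) (h₂ : w₂ ∈ D.W) (hw : w ∈ D.W) :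
    D.B w (w₁ + w₂) = D.B w w₁ * D.B w w₂ := by
  rw [D.B_swap _ w, add_comm, D.B_add_left h₂ h₁ hw, _root_.mul_inv_rev, ← D.B_swap, ← D.B_swap]

theorem B_zsmul_left {w w' : V} (hw : w ∈ D.W) (hw' : w' ∈ D.W) (n : ℤ) :
    D.B ((n : R) • w) w' = D.B w w' ^ n := by
  let φ : Multiplicative D.W →* E := MonoidHom.mk' (fun w => D.B (w.toAdd : V) w') (by
    intro a b
    exact D.B_add_left a.toAdd.2 b.toAdd.2 hw')
  have := map_zpow φ (Multiplicative.ofAdd ⟨w, hw⟩) n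
  rw [← ofAdd_zsmul] at this
  simpa [φ, Int.cast_smul_eq_zsmul] using this

theorem B_zsmul_right {w w' : V} (hw : w ∈ D.W) (hw' : w' ∈ D.W) (n : ℤ) :
    D.B w ((n : R) • w') = D.B w w' ^ n := by
  rw [D.B_swap, D.B_zsmul_left hw' hw, ← _root_.inv_zpow, ← D.B_swap]

theorem B_neg_right {w w' : V} (hw : w ∈ D.W) (hw' : w' ∈ D.W) :
    D.B w (-w') = (D.B w w')⁻¹ := by
  have := D.B_zsmul_right hw hw' (-1)
  simpa using this

theorem B_smul_self {w : V} (hw : w ∈ D.W) (c c' : R) : D.B (c • w) (c' • w) = 1 := by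
  obtain ⟨n, rfl⟩ := IsOddResidueRing.exists_intCast_eq c
  obtain ⟨m, rfl⟩ := IsOddResidueRing.exists_intCast_eq c'
  rw [D.B_zsmul_left hw (D.W.smul_mem _ hw), D.B_zsmul_right hw hw, B, commutatorElement_self]
  simp

theorem B_eq_one_of_hyp {a b w : V} (ha : a ∈ D.W) (hb : b ∈ D.W) (hw : w ∈ D.W)
    (hab : ω a b = 1) (hwa : ω a w = 0) (hwb : ω b w = 0) (c : R) : D.B w (c • a) = 1 := by
  have h2 := two_mul_half R
  have hx : (half R * c) • a ∈ D.W := D.W.smul_mem _ ha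
  set X := D.B w ((half R * c) • a) with hX
  set n := D.lift (planeNeg hab) with hn
  have ha' := D.mem_W.1 ha
  have hb' := D.mem_W.1 hb
  have h1 : n * X * n⁻¹ = X⁻¹ := by
    rw [hX, D.B_conj (c := 1) _ _ hw hx, hn, map_lift,
      planeNeg_smul_of_form_eq_zero _ hwa hwb, Sp.smul_smul_comm, planeNeg_smul_left]
    · simp only [Units.val_one, one_smul, smul_neg]
      rw [D.B_neg_right hw hx]
    · rw [hn, map_lift, planeNeg_smul_of_form_eq_zero _ (form_eq_zero_comm.1 ha'.1)
        (form_eq_zero_comm.1 hb'.1)]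
      simp
    · rw [hn, map_lift, planeNeg_smul_of_form_eq_zero _ (form_eq_zero_comm.1 ha'.2)
        (form_eq_zero_comm.1 hb'.2)]
      simp
  have h3 : π X = 1 := by
    rw [hX, D.map_B hw hx, map_smul, form_eq_zero_comm.1 hwa]
    simp [transv, heis_zero]
  rw [← (D.commute_of_map_eq_one h3 n).eq, mul_inv_cancel_right, eq_inv_iff_mul_eq_one, hX,
    ← D.B_add_right hx hx hw, ← add_smul] at h1
  rw [← h1]
  congr 2
  linear_combination -c * h2

/-- The lift of the transvection along `e 0`. -/
noncomputable def τ₀ (a : R) : E := D.B ((half R * a) • D.e 1) (D.f 1)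

theorem map_τ₀ (a : R) : π (D.τ₀ a) = transv ω (D.e 0) a := by
  have hg := D.two_le
  rw [τ₀, D.map_B (D.W.smul_mem _ (D.e_mem_W one_ne_zero hg)) (D.f_mem_W one_ne_zero hg)]
  simp [D.basis.form_ef hg, ← mul_assoc, two_mul_half R]

theorem τ₀_add (a b : R) : D.τ₀ (a + b) = D.τ₀ a * D.τ₀ b := by
  have hg := D.two_le
  have he := D.e_mem_W one_ne_zero hg
  rw [τ₀, mul_add, add_smul, D.B_add_left (D.W.smul_mem _ he) (D.W.smul_mem _ he)
    (D.f_mem_W one_ne_zero hg), τ₀, τ₀]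

theorem τ₀_zero : D.τ₀ 0 = 1 := by
  have := D.τ₀_add 0 0
  simpa using this

theorem τ₀_neg (a : R) : D.τ₀ (-a) = (D.τ₀ a)⁻¹ := by
  rw [eq_inv_iff_mul_eq_one, ← D.τ₀_add, neg_add_cancel, D.τ₀_zero]

theorem τ₀_two_mul (a : R) : D.τ₀ (2 * a) = D.B (a • D.e 1) (D.f 1) := by
  rw [τ₀, ← mul_assoc, mul_comm _ (2 : R), two_mul_half, one_mul]

theorem B_e_f {i : ℕ} (h0 : i ≠ 0) (hi : i < g) (c : R) :
    D.B (c • D.e i) (D.f i) = D.τ₀ (2 * c) := by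
  rw [τ₀_two_mul]
  by_cases h1 : i = 1
  · rw [h1]
  have hg := D.two_le
  have he := D.e_mem_W one_ne_zero hg
  have hf := D.f_mem_W one_ne_zero hg
  have hei := D.e_mem_W h0 hi
  have hfi := D.f_mem_W h0 hi
  have hce := D.W.smul_mem c he
  have hcei := D.W.smul_mem c hei
  have hb := D.basis
  have e1 := hb.form_ef hg
  have e2 := hb.form_ef hi
  have e3 := hb.form_ef_ne hi hg h1
  have e4 := hb.form_ef_ne hg hi (Ne.symm h1)
  have e5 := hb.form_ee hi hg
  have e6 := form_swap (ω := ω) (D.f i) (D.e i)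
  have e7 := form_swap (ω := ω) (D.f 1) (D.e i)
  have e8 := form_swap (ω := ω) (D.f 1) (D.e 1)
  have e9 := form_swap (ω := ω) (D.f i) (D.e 1)
  have k1 : D.B (c • D.e i + c • D.e 1) ((1 : R) • (D.f i + -D.f 1)) = 1 := by
    apply D.B_eq_one_of_hyp (b := -D.e i) (D.W.add_mem hfi (D.W.neg_mem hf)) (D.W.neg_mem hei)
      (D.W.add_mem hcei hce)
    · simp [e6, e7, e2, e3]
    · simp [e6, e7, e8, e9, e1, e2, e3, e4]
    · simp [e5]
  have k2 : D.B (c • D.e i) ((1 : R) • D.f 1) = 1 := by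
    apply D.B_eq_one_of_hyp (b := - D.e 1) hf (D.W.neg_mem he) hcei
    · simp [e8, e1]
    · simp [e7, e3]
    · simp [form_swap (D.e 1) (D.e i), e5]
  have k3 : D.B (c • D.e 1) ((1 : R) • D.f i) = 1 := by
    apply D.B_eq_one_of_hyp (b := - D.e i) hfi (D.W.neg_mem hei) hce
    · simp [e6, e2]
    · simp [e9, e4]
    · simp [e5]
  rw [one_smul] at k1 k2 k3
  rw [D.B_add_left hcei hce (D.W.add_mem hfi (D.W.neg_mem hf)),
    D.B_add_right hfi (D.W.neg_mem hf) hcei, D.B_add_right hfi (D.W.neg_mem hf) hce,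
    D.B_neg_right hcei hf, D.B_neg_right hce hf, k2, k3] at k1
  simpa [mul_inv_eq_one] using k1

theorem B_e_smul_f {i : ℕ} (h0 : i ≠ 0) (hi : i < g) (c c' : R) :
    D.B (c • D.e i) (c' • D.f i) = D.τ₀ (2 * ω (c • D.e i) (c' • D.f i)) := by
  obtain ⟨n, rfl⟩ := IsOddResidueRing.exists_intCast_eq c'
  have he := D.e_mem_W h0 hi
  have hf := D.f_mem_W h0 hi
  rw [D.B_zsmul_right (D.W.smul_mem _ he) hf, ← D.B_zsmul_left (D.W.smul_mem _ he) hf, smul_smul,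
    D.B_e_f h0 hi]
  simp [D.basis.form_ef hi]

theorem W_induction {p : V → Prop} (h0 : p 0) (hadd : ∀ x y, p x → p y → p (x + y))
    (he : ∀ (i : ℕ) (c : R), i ≠ 0 → i < g → p (c • D.e i))
    (hf : ∀ (i : ℕ) (c : R), i ≠ 0 → i < g → p (c • D.f i)) {w : V} (hw : w ∈ D.W) : p w := by
  rw [D.basis.eq_sum w]
  refine Finset.sum_induction _ p hadd h0 fun i hi => ?_
  rw [Finset.mem_range] at hi
  by_cases hi0 : i = 0
  · have hw := D.mem_W.1 hw
    rw [hi0, hw.1, form_eq_zero_comm.1 hw.2]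
    simpa using h0
  · exact hadd _ _ (he i _ hi0 hi) (hf i _ hi0 hi)

theorem B_e_smul_e {i j : ℕ} (h0 : i ≠ 0) (hi : i < g) (h0' : j ≠ 0) (hj : j < g) (c c' : R) :
    D.B (c • D.e i) (c' • D.e j) = 1 := by
  by_cases hij : i = j
  · subst hij
    exact D.B_smul_self (D.e_mem_W h0 hi) c c'
  apply D.B_eq_one_of_hyp (b := D.f j) (D.e_mem_W h0' hj) (D.f_mem_W h0' hj)
    (D.W.smul_mem _ (D.e_mem_W h0 hi)) (D.basis.form_ef hj)
  · simp [D.basis.form_ee hj hi]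
  · simp [form_swap (D.f j) (D.e i), D.basis.form_ef_ne hi hj hij]

theorem B_f_smul_f {i j : ℕ} (h0 : i ≠ 0) (hi : i < g) (h0' : j ≠ 0) (hj : j < g) (c c' : R) :
    D.B (c • D.f i) (c' • D.f j) = 1 := by
  by_cases hij : i = j
  · subst hij
    exact D.B_smul_self (D.f_mem_W h0 hi) c c'
  apply D.B_eq_one_of_hyp (b := -D.e j) (D.f_mem_W h0' hj) (D.W.neg_mem (D.e_mem_W h0' hj))
    (D.W.smul_mem _ (D.f_mem_W h0 hi))
  · simp [form_swap (D.f j) (D.e j), D.basis.form_ef hj]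
  · simp [D.basis.form_ff hj hi]
  · simp [D.basis.form_ef_ne hj hi (Ne.symm hij)]

theorem B_e_smul_f' {i j : ℕ} (h0 : i ≠ 0) (hi : i < g) (h0' : j ≠ 0) (hj : j < g) (c c' : R) :
    D.B (c • D.e i) (c' • D.f j) = D.τ₀ (2 * ω (c • D.e i) (c' • D.f j)) := by
  by_cases hij : i = j
  · subst hij
    exact D.B_e_smul_f h0 hi c c'
  have h1 : ω (c • D.e i) (c' • D.f j) = 0 := by simp [D.basis.form_ef_ne hi hj hij]
  rw [h1, mul_zero, τ₀_zero]
  apply D.B_eq_one_of_hyp (b := -D.e j) (D.f_mem_W h0' hj) (D.W.neg_mem (D.e_mem_W h0' hj))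
    (D.W.smul_mem _ (D.e_mem_W h0 hi))
  · simp [form_swap (D.f j) (D.e j), D.basis.form_ef hj]
  · simp [form_swap (D.f j) (D.e i), D.basis.form_ef_ne hi hj hij]
  · simp [D.basis.form_ee hj hi]

/-- The commutator of lifts of Heisenberg elements depends only on the form. -/
theorem B_eq_τ₀ {w w' : V} (hw : w ∈ D.W) (hw' : w' ∈ D.W) :
    D.B w w' = D.τ₀ (2 * ω w w') := by
  have add_left : ∀ {x y z : V}, z ∈ D.W → (x ∈ D.W ∧ D.B x z = D.τ₀ (2 * ω x z)) →
      (y ∈ D.W ∧ D.B y z = D.τ₀ (2 * ω y z)) →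
      x + y ∈ D.W ∧ D.B (x + y) z = D.τ₀ (2 * ω (x + y) z) := by
    rintro x y z hz ⟨hx, hx'⟩ ⟨hy, hy'⟩
    refine ⟨D.W.add_mem hx hy, ?_⟩
    rw [D.B_add_left hx hy hz, hx', hy', map_add, LinearMap.add_apply, mul_add, D.τ₀_add]
  have swap : ∀ {x y : V}, D.B x y = D.τ₀ (2 * ω x y) → D.B y x = D.τ₀ (2 * ω y x) := by
    intro x y h
    rw [D.B_swap, h, ← D.τ₀_neg, form_swap y x, mul_neg]
  have zero : ∀ {z : V}, z ∈ D.W → D.B 0 z = D.τ₀ (2 * ω 0 z) := by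
    intro z hz
    have := D.B_add_left D.W.zero_mem D.W.zero_mem hz
    simpa [τ₀_zero] using this
  have h1 : ∀ i (c : R), i ≠ 0 → i < g → ∀ w ∈ D.W,
      D.B w (c • D.e i) = D.τ₀ (2 * ω w (c • D.e i)) := by
    intro i c h0 hi w hw
    have hz := D.W.smul_mem c (D.e_mem_W h0 hi)
    refine (D.W_induction (p := fun w => w ∈ D.W ∧ D.B w (c • D.e i) = D.τ₀ (2 * ω w (c • D.e i)))
      ⟨D.W.zero_mem, zero hz⟩ (fun x y => add_left hz) ?_ ?_ hw).2
    · intro j d h0' hj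
      refine ⟨D.W.smul_mem _ (D.e_mem_W h0' hj), ?_⟩
      rw [D.B_e_smul_e h0' hj h0 hi]
      simp [D.basis.form_ee hj hi, τ₀_zero]
    · intro j d h0' hj
      exact ⟨D.W.smul_mem _ (D.f_mem_W h0' hj), swap (D.B_e_smul_f' h0 hi h0' hj _ _)⟩
  have h2 : ∀ i (c : R), i ≠ 0 → i < g → ∀ w ∈ D.W,
      D.B w (c • D.f i) = D.τ₀ (2 * ω w (c • D.f i)) := by
    intro i c h0 hi w hw
    have hz := D.W.smul_mem c (D.f_mem_W h0 hi)
    refine (D.W_induction (p := fun w => w ∈ D.W ∧ D.B w (c • D.f i) = D.τ₀ (2 * ω w (c • D.f i)))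
      ⟨D.W.zero_mem, zero hz⟩ (fun x y => add_left hz) ?_ ?_ hw).2
    · intro j d h0' hj
      exact ⟨D.W.smul_mem _ (D.e_mem_W h0' hj), D.B_e_smul_f' h0' hj h0 hi _ _⟩
    · intro j d h0' hj
      refine ⟨D.W.smul_mem _ (D.f_mem_W h0' hj), ?_⟩
      rw [D.B_f_smul_f h0' hj h0 hi]
      simp [D.basis.form_ff hj hi, τ₀_zero]
  refine swap (D.W_induction (p := fun x => x ∈ D.W ∧ D.B x w = D.τ₀ (2 * ω x w))
      ⟨D.W.zero_mem, zero hw⟩ (fun x y => add_left hw) ?_ ?_ hw').2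
  · intro j d h0' hj
    exact ⟨D.W.smul_mem _ (D.e_mem_W h0' hj), swap (h1 j d h0' hj w hw)⟩
  · intro j d h0' hj
    exact ⟨D.W.smul_mem _ (D.f_mem_W h0' hj), swap (h2 j d h0' hj w hw)⟩

end CentralExt

end Symp

namespace Symp

open scoped commutatorElement

variable {R V : Type*} [CommRing R] [AddCommGroup V] [Module R V]
variable {ω : V →ₗ[R] V →ₗ[R] R} [hω : Fact ω.IsAlt]

/-- The symplectic group acts transitively on unimodular vectors. -/
theorem exists_smul_eq [IsLocalRing R] {u v : V} (hu : Uni ω u) (hv : Uni ω v) :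
    ∃ M : Sp ω, M • u = v := by
  obtain ⟨x, -, hux, hvx⟩ := exists_adj₂ (hasPartners_top (ω := ω)) trivial trivial hu hv
  exact ⟨transv ω (v - x) (-Ring.inverse (ω x v)) * transv ω (x - u) (-Ring.inverse (ω u x)), by
    rw [mul_smul, transv_sub_smul hux, transv_sub_smul hvx.symm]⟩

namespace CentralExt

variable {E : Type*} [Group E] {π : E →* Sp ω} {g : ℕ} (D : CentralExt π g)
variable [IsOddResidueRing R]

theorem τ₀_conj {ε : E} {c : Rˣ} (he : π ε • D.e 0 = (c : R) • D.e 0)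
    (hf : π ε • D.f 0 = (↑c⁻¹ : R) • D.f 0) (a : R) :
    ε * D.τ₀ a * ε⁻¹ = D.τ₀ (c ^ 2 * a) := by
  have hg := D.two_le
  have h1 := D.W.smul_mem (half R * a) (D.e_mem_W one_ne_zero hg)
  have h2 := D.f_mem_W one_ne_zero hg
  rw [τ₀, D.B_conj he hf h1 h2, D.B_eq_τ₀ (D.W.smul_mem _ (D.smul_mem_W he hf h1))
    (D.W.smul_mem _ (D.smul_mem_W he hf h2))]
  congr 1
  simp only [map_smul, LinearMap.smul_apply, form_smul_smul, D.basis.form_ef hg, smul_eq_mul]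
  linear_combination (c : R) ^ 2 * a * two_mul_half R

theorem commute_τ₀ {η : E} {b : R} {w : V} (hw : w ∈ D.W) (hη : π η = heis ω (D.e 0) w b)
    (a : R) : Commute η (D.τ₀ a) := D.commute_heis_lift hw (D.map_τ₀ a) hη

/-- The canonical lift of a Heisenberg element. -/
noncomputable def s (w : V) : E :=
  ⁅D.lift (planeNeg D.form_e_f), D.lift (heis ω (D.e 0) (-half R • w) 0)⁆

theorem map_s {w : V} (hw : w ∈ D.W) : π (D.s w) = heis ω (D.e 0) w 0 := by
  rw [s, map_commutatorElement, map_lift, map_lift, D.commutator_planeNeg hw]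

theorem commutator_eq_s {w : V} (hw : w ∈ D.W) {m ε : E} {a : R}
    (hm : π m = planeNeg D.form_e_f) (hε : π ε = heis ω (D.e 0) (-half R • w) a) :
    ⁅m, ε⁆ = D.s w := by
  set x := D.lift (heis ω (D.e 0) (-half R • w) 0) with hx
  have hw' : -half R • w ∈ D.W := D.W.smul_mem _ hw
  have h1 : π (x⁻¹ * ε) = transv ω (D.e 0) a := by
    rw [map_mul, map_inv, inv_mul_eq_iff_eq_mul, hε, map_lift, heis_mul_transv (D.mem_W.1 hw').1,
      zero_add]
  have h2 : ⁅m, ε⁆ = ⁅m, x⁆ := by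
    have h3 := D.commute_planeNeg h1 hm
    have h4 : ε = x * (x⁻¹ * ε) := by group
    generalize x⁻¹ * ε = t at h3 h4
    subst h4
    rw [commutatorElement_def, commutatorElement_def]
    calc m * (x * t) * m⁻¹ * (x * t)⁻¹ = m * x * (t * m⁻¹) * t⁻¹ * x⁻¹ := by group
      _ = _ := by rw [h3.inv_right.eq]; group
  rw [h2, s, ← hx, commutatorElement_def, commutatorElement_def,
    conj_eq_of_map_eq D.ker_le (hm.trans (D.map_lift _).symm)]

theorem s_conj {ε : E} {c : Rˣ} (he : π ε • D.e 0 = (c : R) • D.e 0)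
    (hf : π ε • D.f 0 = (↑c⁻¹ : R) • D.f 0) {w : V} (hw : w ∈ D.W) :
    ε * D.s w * ε⁻¹ = D.s ((c : R) • π ε • w) := by
  have hw' := D.W.smul_mem (c : R) (D.smul_mem_W he hf hw)
  rw [← D.commutator_eq_s hw' (m := ε * D.lift (planeNeg D.form_e_f) * ε⁻¹)
    (ε := ε * D.lift (heis ω (D.e 0) (-half R • w) 0) * ε⁻¹) (a := c ^ 2 * 0), s]
  · simp only [commutatorElement_def]
    group
  · rw [map_mul, map_mul, map_inv, map_lift, planeNeg_conj _ _ c he hf]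
  · rw [map_mul, map_mul, map_inv, map_lift, D.conj_heis he, Sp.smul_smul_comm, smul_comm]

theorem s_mul {w w' : V} (hw : w ∈ D.W) (hw' : w' ∈ D.W) :
    D.s w * D.s w' = D.s (w + w') * D.τ₀ (ω w w') := by
  set m := D.lift (planeNeg D.form_e_f) with hm
  set x := D.lift (heis ω (D.e 0) (-half R • w) 0) with hx
  set y := D.lift (heis ω (D.e 0) (-half R • w') 0) with hy
  have h1 : ω (D.e 0) (-half R • w) = 0 := by simp [(D.mem_W.1 hw).1]
  have h2 : ω (D.e 0) (-half R • w') = 0 := by simp [(D.mem_W.1 hw').1]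
  have hxy : π (x * y) = heis ω (D.e 0) (-half R • (w + w'))
      (0 + 0 + ω (-half R • w) (-half R • w')) := by
    rw [map_mul, map_lift, map_lift, heis_mul h1 h2, smul_add]
  have hB : ⁅x, D.s w'⁆ = D.τ₀ (-ω w w') := by
    rw [D.commutator_eq_B (D.W.smul_mem _ hw) hw' (D.map_lift _) (D.map_s hw'),
      D.B_eq_τ₀ (D.W.smul_mem _ hw) hw']
    congr 1
    simp only [map_smul, LinearMap.smul_apply, smul_eq_mul]
    linear_combination -ω w w' * two_mul_half R
  have h3 : D.s (w + w') = D.s w * ⁅x, D.s w'⁆ * D.s w' := by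
    rw [← D.commutator_eq_s (D.W.add_mem hw hw') (D.map_lift _) hxy]
    rw [s, s, ← hm, ← hx, ← hy]
    simp only [commutatorElement_def]
    group
  have h4 := (D.commute_τ₀ hw' (D.map_s hw') (-ω w w')).eq
  rw [h3, hB, mul_assoc (D.s w), ← h4, ← mul_assoc, mul_assoc _ (D.τ₀ _), ← D.τ₀_add]
  simp [τ₀_zero]

/-- The canonical lift of a general element of the Heisenberg group at `e 0`. -/
noncomputable def q₀ (w : V) (a : R) : E :=
  D.s (w - ω w (D.f 0) • D.e 0) * D.τ₀ (a + 2 * ω w (D.f 0))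

theorem sub_mem_W {w : V} (hw : ω (D.e 0) w = 0) : w - ω w (D.f 0) • D.e 0 ∈ D.W := by
  rw [mem_W]
  simp [hw, form_swap (D.f 0) (D.e 0), D.form_e_f, form_swap (D.f 0) w]

theorem map_q₀ {w : V} (hw : ω (D.e 0) w = 0) (a : R) : π (D.q₀ w a) = heis ω (D.e 0) w a := by
  have h1 := D.sub_mem_W hw
  rw [q₀, map_mul, D.map_s h1, D.map_τ₀, heis_mul_transv (D.mem_W.1 h1).1, zero_add,
    ← heis_smul_add_smul (D.mem_W.1 h1).1, sub_add_cancel]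

theorem q₀_mul {w w' : V} (hw : ω (D.e 0) w = 0) (hw' : ω (D.e 0) w' = 0) (a b : R) :
    D.q₀ w a * D.q₀ w' b = D.q₀ (w + w') (a + b + ω w w') := by
  have h1 := D.sub_mem_W hw
  have h2 := D.sub_mem_W hw'
  have h3 := (D.commute_τ₀ h2 (D.map_s h2) (a + 2 * ω w (D.f 0))).eq
  have h4 : w - ω w (D.f 0) • D.e 0 + (w' - ω w' (D.f 0) • D.e 0) =
      (w + w') - ω (w + w') (D.f 0) • D.e 0 := by
    rw [map_add, LinearMap.add_apply]
    module
  have h5 : ω (w - ω w (D.f 0) • D.e 0) (w' - ω w' (D.f 0) • D.e 0) = ω w w' := by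
    simp [hw', form_eq_zero_comm.1 hw]
  rw [q₀, q₀, mul_assoc, ← mul_assoc (D.τ₀ _), ← h3, mul_assoc (D.s _), ← mul_assoc,
    D.s_mul h1 h2, mul_assoc, ← D.τ₀_add, ← D.τ₀_add, h4, h5, q₀]
  congr 2
  rw [map_add, LinearMap.add_apply]
  ring

theorem q₀_add_smul (w : V) (d a : R) : D.q₀ (w + d • D.e 0) a = D.q₀ w (a + 2 * d) := by
  rw [q₀, q₀]
  congr 2
  · simp only [map_add, map_smul, LinearMap.add_apply, LinearMap.smul_apply, D.form_e_f,
      smul_eq_mul]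
    module
  · simp only [map_add, map_smul, LinearMap.add_apply, LinearMap.smul_apply, D.form_e_f,
      smul_eq_mul]
    ring

theorem q₀_conj_of_smul_f {ε : E} {c : Rˣ} (he : π ε • D.e 0 = (c : R) • D.e 0)
    (hf : π ε • D.f 0 = (↑c⁻¹ : R) • D.f 0) {w : V} (hw : ω (D.e 0) w = 0) (a : R) :
    ε * D.q₀ w a * ε⁻¹ = D.q₀ ((c : R) • π ε • w) (c ^ 2 * a) := by
  have h1 := D.sub_mem_W hw
  have h2 : (π ε)⁻¹ • D.f 0 = (c : R) • D.f 0 := by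
    rw [inv_smul_eq_iff, Sp.smul_smul_comm, hf, smul_smul]
    simp
  have h3 : ε * D.q₀ w a * ε⁻¹ = (ε * D.s (w - ω w (D.f 0) • D.e 0) * ε⁻¹) *
      (ε * D.τ₀ (a + 2 * ω w (D.f 0)) * ε⁻¹) := by
    rw [q₀]
    group
  rw [h3, D.s_conj he hf h1, D.τ₀_conj he hf, q₀]
  simp only [map_smul, LinearMap.smul_apply, smul_eq_mul, form_smul_left, h2, smul_sub,
    Sp.smul_smul_comm, he]
  congr 2
  · generalize π ε • w = z
    module
  · ring

theorem q₀_conj {ε : E} {c : Rˣ} (he : π ε • D.e 0 = (c : R) • D.e 0) {w : V}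
    (hw : ω (D.e 0) w = 0) (a : R) :
    ε * D.q₀ w a * ε⁻¹ = D.q₀ ((c : R) • π ε • w) (c ^ 2 * a) := by
  set y := (c : R) • π ε • D.f 0 - D.f 0 with hy
  have hcc := Units.mul_inv c
  have he' : (π ε)⁻¹ • D.e 0 = (↑c⁻¹ : R) • D.e 0 := by
    rw [inv_smul_eq_iff, Sp.smul_smul_comm, he, smul_smul]
    simp
  have hey : ω (D.e 0) y = 0 := by
    rw [hy, map_sub, map_smul, form_smul_right, he', map_smul, LinearMap.smul_apply, D.form_e_f]
    simp
  set κ := D.q₀ y (-ω y (D.f 0)) with hκ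
  have hκf : π κ • D.f 0 = (c : R) • π ε • D.f 0 := by
    rw [hκ, D.map_q₀ hey, heis_smul hey, D.form_e_f]
    have : (c : R) • π ε • D.f 0 = D.f 0 + y := by rw [hy, add_sub_cancel]
    rw [this]
    clear_value y
    module
  have hκe : π κ • D.e 0 = D.e 0 := by rw [hκ, D.map_q₀ hey, heis_smul_self hey]
  have h1 : π (κ⁻¹ * ε) • D.e 0 = (c : R) • D.e 0 := by
    rw [map_mul, mul_smul, he, map_inv, Sp.smul_smul_comm, inv_smul_eq_iff.2 hκe.symm]
  have h2 : π (κ⁻¹ * ε) • D.f 0 = (↑c⁻¹ : R) • D.f 0 := by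
    rw [map_mul, mul_smul, map_inv, inv_smul_eq_iff, Sp.smul_smul_comm, hκf, smul_smul]
    simp
  have h3 := D.q₀_conj_of_smul_f h1 h2 hw a
  have h4 : ∀ u b, ω (D.e 0) u = 0 → κ * D.q₀ u b * κ⁻¹ = D.q₀ (π κ • u) b := by
    intro u b hu
    have h5 : π κ • u = u + ω y u • D.e 0 := by
      rw [hκ, D.map_q₀ hey, heis_smul hey, hu]
      simp
    rw [h5, q₀_add_smul, mul_inv_eq_iff_eq_mul, hκ, D.q₀_mul hey hu, D.q₀_mul hu hey,
      form_swap u y, add_comm u]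
    congr 1
    ring
  have h6 : ω (D.e 0) ((c : R) • π (κ⁻¹ * ε) • w) = 0 := by
    have h7 : ω (π (κ⁻¹ * ε) • D.e 0) (π (κ⁻¹ * ε) • w) = 0 := by rw [form_smul_smul, hw]
    rw [h1] at h7
    simpa using h7
  have h8 := h4 _ (c ^ 2 * a) h6
  rw [← h3, Sp.smul_smul_comm, ← mul_smul, ← map_mul, mul_inv_cancel_left] at h8
  rw [← h8]
  group

theorem uni_e : Uni ω (D.e 0) := ⟨_, D.form_e_f⟩

theorem exists_map_smul_eq {v : V} (hv : Uni ω v) : ∃ ε : E, π ε • D.e 0 = v := by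
  obtain ⟨M, hM⟩ := exists_smul_eq D.uni_e hv
  exact ⟨D.lift M, by rw [map_lift, hM]⟩

open Classical in
/-- An element of the extension moving `e 0` to `v`. -/
noncomputable def mover (v : V) : E :=
  if hv : Uni ω v then (D.exists_map_smul_eq hv).choose else 1

theorem mover_smul {v : V} (hv : Uni ω v) : π (D.mover v) • D.e 0 = v := by
  rw [mover, dif_pos hv]
  exact (D.exists_map_smul_eq hv).choose_spec

/-- The canonical lift of a Heisenberg element. -/
noncomputable def q (v w : V) (a : R) : E :=
  D.mover v * D.q₀ ((π (D.mover v))⁻¹ • w) a * (D.mover v)⁻¹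

theorem conj_q₀ {v u : V} (hv : Uni ω v) {ε : E} {c : Rˣ} (h : π ε • D.e 0 = (c : R) • v)
    (hu : ω (D.e 0) u = 0) (a : R) :
    ε * D.q₀ u a * ε⁻¹ = D.q v ((c : R) • π ε • u) (c ^ 2 * a) := by
  have h1 : π ((D.mover v)⁻¹ * ε) • D.e 0 = (c : R) • D.e 0 := by
    rw [map_mul, mul_smul, h, map_inv, inv_smul_eq_iff, Sp.smul_smul_comm, D.mover_smul hv]
  have h2 := D.q₀_conj h1 hu a
  rw [q, Sp.smul_smul_comm, ← mul_smul, ← map_inv, ← map_mul, ← h2]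
  group

/-- A central extension of the symplectic group has a canonical system of lifts of the Heisenberg
elements. -/
noncomputable def heisLift : HeisLift π where
  q := D.q
  map_q {v w} hv h a := by
    have h1 : ω (D.e 0) ((π (D.mover v))⁻¹ • w) = 0 := by
      rw [form_smul_right, inv_inv, D.mover_smul hv, h]
    rw [q, map_mul, map_mul, map_inv, D.map_q₀ h1, heis_conj, D.mover_smul hv, smul_inv_smul]
  q_mul {v w w'} hv h h' a b := by
    have h1 : ω (D.e 0) ((π (D.mover v))⁻¹ • w) = 0 := by
      rw [form_smul_right, inv_inv, D.mover_smul hv, h]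
    have h2 : ω (D.e 0) ((π (D.mover v))⁻¹ • w') = 0 := by
      rw [form_smul_right, inv_inv, D.mover_smul hv, h']
    have h3 := D.q₀_mul h1 h2 a b
    rw [form_smul_smul] at h3
    rw [q, q, q, smul_add, ← h3]
    group
  q_conj {v w} hv h a ε := by
    have h1 : ω (D.e 0) ((π (D.mover v))⁻¹ • w) = 0 := by
      rw [form_smul_right, inv_inv, D.mover_smul hv, h]
    have h2 := D.conj_q₀ (c := 1) (hv.smul (π ε)) (ε := ε * D.mover v)
      (by rw [map_mul, mul_smul, D.mover_smul hv]; simp) h1 a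
    rw [map_mul, mul_smul, smul_inv_smul, Units.val_one, one_smul, one_pow, one_mul] at h2
    rw [← h2, q]
    group
  q_scale {v w} hv h a c := by
    have h1 : ω (D.e 0) ((π (D.mover ((c : R) • v)))⁻¹ • w) = 0 := by
      rw [form_smul_right, inv_inv, D.mover_smul (hv.unit_smul c)]
      simp [h]
    have h2 := D.conj_q₀ (c := c) hv (D.mover_smul (hv.unit_smul c)) h1 a
    rw [smul_inv_smul] at h2
    rw [← h2, q]

end CentralExt

end Symp

namespace Symp

open scoped commutatorElement

variable {R V : Type*} [CommRing R] [AddCommGroup V] [Module R V]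
variable {ω : V →ₗ[R] V →ₗ[R] R} [hω : Fact ω.IsAlt]

namespace IsHypExt

variable {U U' : Submodule R V} {z s : V}

omit hω in
theorem exists_eq (hX : IsHypExt ω U z s U') {x : V} (hx : x ∈ U') :
    ∃ (a b : R) (u : V), u ∈ U ∧ x = a • z + b • s + u :=
  ⟨_, _, _, hX.sub_mem x hx, by abel⟩

theorem form_u_z (hX : IsHypExt ω U z s U') {u : V} (hu : u ∈ U) : ω u z = 0 :=
  form_eq_zero_comm.1 (hX.form_z u hu)

theorem form_u_s (hX : IsHypExt ω U z s U') {u : V} (hu : u ∈ U) : ω u s = 0 :=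
  form_eq_zero_comm.1 (hX.form_s u hu)

theorem hasPartners [IsLocalRing R] (hX : IsHypExt ω U z s U') (hU : HasPartners ω U) :
    HasPartners ω U' := by
  rintro v hv ⟨x, hx⟩
  obtain ⟨a, b, u, hu, rfl⟩ := hX.exists_eq hv
  have hsz : ω s z = -1 := by rw [form_swap, hX.form]
  by_cases ha : IsUnit a
  · refine ⟨Ring.inverse a • s, U'.smul_mem _ hX.s_mem, ?_⟩
    simp [hX.form, hX.form_u_s hu, Ring.inverse_mul_cancel a ha]
  by_cases hb : IsUnit b
  · refine ⟨-Ring.inverse b • z, U'.smul_mem _ hX.z_mem, ?_⟩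
    simp [hsz, hX.form_u_z hu, Ring.mul_inverse_cancel b hb]
  have h1 : IsUnit (ω u x) := by
    by_contra h
    have h2 : ¬ IsUnit (a * ω z x) := fun h => ha (isUnit_of_mul_isUnit_left h)
    have h3 : ¬ IsUnit (b * ω s x) := fun h => hb (isUnit_of_mul_isUnit_left h)
    have h4 := IsLocalRing.nonunits_add (IsLocalRing.nonunits_add h2 h3) h
    simp only [map_add, map_smul, LinearMap.add_apply, LinearMap.smul_apply, smul_eq_mul] at hx
    rw [hx] at h4
    exact h4 isUnit_one
  obtain ⟨y, hy, huy⟩ := hU u hu (uni_of_isUnit h1)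
  exact ⟨y, hX.le hy, by simp [hX.form_z y hy, hX.form_s y hy, huy]⟩

theorem hasDiv (hX : IsHypExt ω U z s U') (hd : ∀ a b : R, a ∣ b ∨ b ∣ a)
    (hU : HasPartners ω U) (hD : HasDiv ω U) : HasDiv ω U' := by
  intro r hr
  obtain ⟨a, b, u, hu, rfl⟩ := hX.exists_eq hr
  obtain ⟨c, y, hy, hyU, rfl⟩ := hD u hu
  obtain ⟨x, hx, hyx⟩ := hU y hy hyU
  have hsz : ω s z = -1 := by rw [form_swap, hX.form]
  have mem (a b c : R) : a • z + b • s + c • y ∈ U' :=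
    U'.add_mem (U'.add_mem (U'.smul_mem _ hX.z_mem) (U'.smul_mem _ hX.s_mem))
      (U'.smul_mem _ (hX.le hy))
  have key : (a ∣ b ∧ a ∣ c) ∨ (b ∣ a ∧ b ∣ c) ∨ (c ∣ a ∧ c ∣ b) := by
    rcases hd a b with h1 | h1 <;> rcases hd b c with h2 | h2 <;> rcases hd a c with h3 | h3
    all_goals first
      | exact Or.inl ⟨h1, h3⟩
      | exact Or.inl ⟨h1, h1.trans h2⟩
      | exact Or.inr (Or.inl ⟨h1, h2⟩)
      | exact Or.inr (Or.inr ⟨h3, h2⟩)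
      | exact Or.inr (Or.inr ⟨h2.trans h1, h2⟩)
  rcases key with ⟨⟨b, rfl⟩, ⟨c, rfl⟩⟩ | ⟨⟨a, rfl⟩, ⟨c, rfl⟩⟩ | ⟨⟨a, rfl⟩, ⟨b, rfl⟩⟩
  · exact ⟨a, _, mem 1 b c, ⟨s, by simp [hX.form, hX.form_u_s hy]⟩, by module⟩
  · exact ⟨b, _, mem a 1 c, ⟨-z, by simp [hsz, hX.form_u_z hy]⟩, by module⟩
  · exact ⟨c, _, mem a b 1, ⟨x, by simp [hX.form_z x hx, hX.form_s x hx, hyx]⟩, by module⟩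

end IsHypExt

/-- The vectors orthogonal to all members of a symplectic basis but the first `k` pairs. -/
def flag (ω : V →ₗ[R] V →ₗ[R] R) (g : ℕ) (e f : ℕ → V) (k : ℕ) : Submodule R V where
  carrier := {x | ∀ i, k ≤ i → i < g → ω (e i) x = 0 ∧ ω (f i) x = 0}
  zero_mem' := by simp
  add_mem' := by
    intro x y hx hy i h1 h2
    simp [hx i h1 h2, hy i h1 h2]
  smul_mem' := by
    intro c x hx i h1 h2
    simp [hx i h1 h2]

namespace IsSympBasis

variable {g : ℕ} {e f : ℕ → V} (hb : IsSympBasis ω g e f)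

include hb

theorem form_fe {i : ℕ} (h : i < g) : ω (f i) (e i) = -1 := by rw [form_swap, hb.form_ef h]

theorem form_fe_ne {i j : ℕ} (hi : i < g) (hj : j < g) (hij : i ≠ j) : ω (f i) (e j) = 0 :=
  form_eq_zero_comm.1 (hb.form_ef_ne hj hi hij.symm)

theorem isHypExt {k : ℕ} (hk : k < g) :
    IsHypExt ω (flag ω g e f k) (e k) (f k) (flag ω g e f (k + 1)) where
  z_mem i h1 h2 := ⟨hb.form_ee h2 hk, hb.form_fe_ne h2 hk (by omega)⟩
  s_mem i h1 h2 := ⟨hb.form_ef_ne h2 hk (by omega), hb.form_ff h2 hk⟩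
  form := hb.form_ef hk
  le x hx i h1 h2 := hx i (by omega) h2
  form_z u hu := (hu k le_rfl hk).1
  form_s u hu := (hu k le_rfl hk).2
  sub_mem x hx i h1 h2 := by
    rcases h1.eq_or_lt with rfl | h1
    · simp [hb.form_ef h2, hb.form_fe h2, form_swap x (f k)]
    · simp [hx i h1 h2, hb.form_ee h2 hk, hb.form_ff h2 hk, hb.form_ef_ne h2 hk h1.ne',
        hb.form_fe_ne h2 hk h1.ne']

theorem eq_zero_of_mem_flag_zero {x : V} (hx : x ∈ flag ω g e f 0) : x = 0 := by
  rw [hb.eq_sum x]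
  refine Finset.sum_eq_zero fun i hi => ?_
  have := hx i (Nat.zero_le _) (Finset.mem_range.1 hi)
  simp [this.1, form_eq_zero_comm.1 this.2]

omit hb hω in
theorem flag_self : flag ω g e f g = ⊤ := by
  refine eq_top_iff.2 fun x _ i h1 h2 => by omega

theorem hasPartners_flag [IsLocalRing R] {k : ℕ} (hk : k ≤ g) :
    HasPartners ω (flag ω g e f k) := by
  induction k with
  | zero =>
    rintro v hv ⟨x, hx⟩
    rw [hb.eq_zero_of_mem_flag_zero hv] at hx
    simp at hx
  | succ k ih => exact (hb.isHypExt hk).hasPartners (ih (by omega))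

theorem eq_of_mem_flag_one (hg : 0 < g) {x : V} (hx : x ∈ flag ω g e f 1) :
    x = ω x (f 0) • e 0 + ω (e 0) x • f 0 :=
  sub_eq_zero.1 (hb.eq_zero_of_mem_flag_zero ((hb.isHypExt hg).sub_mem x hx))

variable [IsOddResidueRing R]

theorem hasDiv_flag {k : ℕ} (hk : k < g) : HasDiv ω (flag ω g e f (k + 1)) := by
  induction k with
  | zero =>
    intro r hr
    have hX := hb.isHypExt hk
    have mem (a b : R) : a • e 0 + b • f 0 ∈ flag ω g e f 1 :=
      Submodule.add_mem _ (Submodule.smul_mem _ _ hX.z_mem) (Submodule.smul_mem _ _ hX.s_mem)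
    have h := hb.eq_of_mem_flag_one hk hr
    rcases IsOddResidueRing.dvd_total (ω r (f 0)) (ω (e 0) r) with ⟨c, hc⟩ | ⟨c, hc⟩
    · refine ⟨ω r (f 0), _, mem 1 c, ⟨f 0, by simp [hb.form_ef hk]⟩, ?_⟩
      rw [hc] at h
      nth_rw 1 [h]
      module
    · refine ⟨ω (e 0) r, _, mem c 1, ⟨-e 0, by simp [hb.form_fe hk]⟩, ?_⟩
      rw [hc] at h
      nth_rw 1 [h]
      module
  | succ k ih =>
    exact (hb.isHypExt hk).hasDiv IsOddResidueRing.dvd_total (hb.hasPartners_flag hk.le)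
      (ih (by omega))

variable {E : Type*} [Group E] {π : E →* Sp ω} (L : HeisLift π)

theorem faithful_flag (hker : π.ker ≤ Subgroup.center E) {k : ℕ} (hk : k < g) :
    L.Faithful (flag ω g e f (k + 1)) := by
  induction k with
  | zero =>
    have hX := hb.isHypExt hk
    exact L.faithful_plane hX.form hX.z_mem hX.s_mem (fun x hx => hb.eq_of_mem_flag_one hk hx) hker
  | succ k ih =>
    exact (ih (by omega)).hypExt IsOddResidueRing.isUnit_two (hb.isHypExt hk)
      (hb.hasPartners_flag hk.le) (hb.hasDiv_flag (by omega)) (hb.hasPartners_flag hk)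

theorem faithful_top (hker : π.ker ≤ Subgroup.center E) (hg : 0 < g) : L.Faithful ⊤ := by
  obtain ⟨k, rfl⟩ : ∃ k, g = k + 1 := ⟨g - 1, by omega⟩
  have := hb.faithful_flag L hker (Nat.lt_succ_self k)
  rwa [flag_self] at this

theorem exists_mem_elem_flag {k : ℕ} (hk : k ≤ g) (M : Sp ω)
    (hM : ∀ i, k ≤ i → i < g → M • e i = e i ∧ M • f i = f i) :
    ∃ ε ∈ L.elem (flag ω g e f k), π ε = M := by
  induction k generalizing M with
  | zero =>
    refine ⟨1, one_mem _, ?_⟩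
    rw [map_one]
    refine (Sp.ext fun x => ?_).symm
    rw [one_smul, hb.eq_sum (M • x)]
    conv_rhs => rw [hb.eq_sum x]
    refine Finset.sum_congr rfl fun i hi => ?_
    have := hM i (Nat.zero_le _) (Finset.mem_range.1 hi)
    have h1 : ω (M • x) (f i) = ω x (f i) := by
      conv_lhs => rw [← this.2]
      exact form_smul_smul _ _ _
    have h2 : ω (e i) (M • x) = ω (e i) x := by
      conv_lhs => rw [← this.1]
      exact form_smul_smul _ _ _
    rw [h1, h2]
  | succ k ih =>
    have hX := hb.isHypExt hk
    have mem (x : V) (hx : x ∈ flag ω g e f (k + 1)) : M • x ∈ flag ω g e f (k + 1) := by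
      intro i h1 h2
      have := hM i h1 h2
      have h3 := hx i h1 h2
      rw [← form_smul_smul M, ← form_smul_smul M (f i), this.1, this.2] at h3
      exact h3
    obtain ⟨ε, hε, h1, h2⟩ := L.exists_elem_smul_pair (hb.hasPartners_flag hk) hX.z_mem hX.s_mem
      (mem _ hX.z_mem) (mem _ hX.s_mem) (by rw [Adj, hX.form]; exact isUnit_one)
      (form_smul_smul _ _ _).symm
    obtain ⟨η, hη, h3⟩ := ih (by omega) ((π ε)⁻¹ * M) (by
      intro i hi hi'
      rcases hi.eq_or_lt with rfl | hi
      · rw [mul_smul, mul_smul, inv_smul_eq_iff, inv_smul_eq_iff]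
        exact ⟨h1.symm, h2.symm⟩
      · have := hM i hi hi'
        rw [mul_smul, mul_smul, inv_smul_eq_iff, inv_smul_eq_iff, this.1, this.2]
        exact ⟨(L.elem_smul_eq hε fun u hu => form_eq_zero_comm.1 (hu i hi hi').1).symm,
          (L.elem_smul_eq hε fun u hu => form_eq_zero_comm.1 (hu i hi hi').2).symm⟩)
    exact ⟨ε * η, mul_mem hε (L.elem_mono hX.le hη), by rw [map_mul, h3, mul_inv_cancel_left]⟩

theorem exists_mem_elem_top (M : Sp ω) : ∃ ε ∈ L.elem ⊤, π ε = M := by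
  have := hb.exists_mem_elem_flag L le_rfl M (fun i h1 h2 => by omega)
  rwa [flag_self] at this

/-- The symplectic group is perfect. -/
theorem commutator_eq_top (hg : 2 ≤ g) : commutator (Sp ω) = ⊤ := by
  let L : HeisLift (MonoidHom.id (Sp ω)) :=
    { q := heis ω
      map_q := fun _ _ _ => rfl
      q_mul := fun _ h h' a b => heis_mul h h' a b
      q_conj := fun _ _ a ε => heis_conj ε _ _ a
      q_scale := fun _ _ a c => heis_scale c _ _ a }
  refine eq_top_iff.2 fun M _ => ?_
  obtain ⟨ε, hε, rfl⟩ := hb.exists_mem_elem_top L M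
  have : L.elem ⊤ ≤ commutator (Sp ω) := by
    refine (Subgroup.closure_le _).2 ?_
    rintro _ ⟨u, -, hu, a, rfl⟩
    have h0 : 0 < g := by omega
    obtain ⟨M, rfl⟩ := exists_smul_eq (u := e 0) ⟨f 0, hb.form_ef h0⟩ hu
    have h1 : ω (e 0) ((half R * a) • e 1) = 0 := by simp [hb.form_ee h0 hg]
    have h2 : ω (e 0) (f 1) = 0 := hb.form_ef_ne h0 hg zero_ne_one
    have h3 : L.τ (M • e 0) a =
        M * ⁅heis ω (e 0) ((half R * a) • e 1) 0, heis ω (e 0) (f 1) 0⁆ * M⁻¹ := by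
      change transv ω (M • e 0) a = _
      rw [heis_commutator h1 h2, heis_conj, smul_zero]
      congr 1
      simp only [map_smul, LinearMap.smul_apply, hb.form_ef hg, smul_eq_mul]
      linear_combination -a * two_mul_half R
    rw [h3]
    exact (inferInstance : (commutator (Sp ω)).Normal).conj_mem _
      (Subgroup.commutator_mem_commutator trivial trivial) M
  exact this hε

end IsSympBasis

namespace CentralExt

variable {E : Type*} [Group E] {π : E →* Sp ω} {g : ℕ} (D : CentralExt π g)
variable [IsOddResidueRing R]

include D in
/-- Every central extension of the symplectic group splits. -/
theorem exists_section : ∃ σ : Sp ω →* E, π.comp σ = MonoidHom.id _ := by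
  have hF := D.basis.faithful_top D.heisLift D.ker_le (by have := D.two_le; omega)
  choose σ hσ hπ using D.basis.exists_mem_elem_top D.heisLift
  refine ⟨⟨⟨σ, hF.eq (hσ _) (one_mem _) (by rw [hπ, map_one])⟩, fun M M' =>
    hF.eq (hσ _) (mul_mem (hσ _) (hσ _)) (by simp [hπ])⟩, MonoidHom.ext hπ⟩

end CentralExt

end Symp

/-- A perfect group all of whose central extensions split. -/
structure IsSuperperfect (G : Type) [Group G] : Prop where
  commutator_eq_top : commutator G = ⊤
  exists_section (E : Type) [Group E] (π : E →* G) : Function.Surjective π →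
    π.ker ≤ Subgroup.center E → ∃ σ : G →* E, π.comp σ = MonoidHom.id G

namespace IsSuperperfect

open scoped commutatorElement

variable {G H : Type} [Group G] [Group H]

theorem monoidHom_apply_eq_one (h : commutator G = ⊤) {A : Type*} [Group A]
    (hA : ∀ a b : A, a * b = b * a) (φ : G →* A) (x : G) : φ x = 1 := by
  have : commutator G ≤ φ.ker := by
    rw [commutator_def, Subgroup.commutator_le]
    intro a _ b _
    rw [MonoidHom.mem_ker, map_commutatorElement, commutatorElement_eq_one_iff_mul_comm]
    exact hA _ _
  rw [h] at this
  exact this trivial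

theorem commute_of_commutatorElement_mem_center (h : commutator G = ⊤) {E : Type*} [Group E]
    (σ : G →* E) {y : E} (hy : ∀ x, ⁅σ x, y⁆ ∈ Subgroup.center E) (x : G) :
    Commute (σ x) y := by
  let φ : G →* Subgroup.center E :=
    { toFun := fun x => ⟨⁅σ x, y⁆, hy x⟩
      map_one' := by simp
      map_mul' := by
        intro a b
        ext
        have h1 : σ a * ⁅σ b, y⁆ = ⁅σ b, y⁆ * σ a := Subgroup.mem_center_iff.1 (hy b) _
        have h2 : ⁅σ a, y⁆ * ⁅σ b, y⁆ = ⁅σ b, y⁆ * ⁅σ a, y⁆ :=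
          Subgroup.mem_center_iff.1 (hy b) _
        rw [Subgroup.coe_mul, h2]
        calc ⁅σ (a * b), y⁆ = σ a * ⁅σ b, y⁆ * (y * (σ a)⁻¹ * y⁻¹) := by
              rw [map_mul]
              simp only [commutatorElement_def]
              group
          _ = ⁅σ b, y⁆ * ⁅σ a, y⁆ := by
              rw [h1]
              simp only [commutatorElement_def]
              group }
  have := congrArg Subtype.val (monoidHom_apply_eq_one h
    (fun a b => Subtype.ext (Subgroup.mem_center_iff.1 b.2 a)) φ x)
  exact commutatorElement_eq_one_iff_commute.1 this

theorem of_mulEquiv (hG : IsSuperperfect G) (φ : G ≃* H) : IsSuperperfect H where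
  commutator_eq_top := by
    rw [← Subgroup.map_top_of_surjective φ.toMonoidHom φ.surjective, ← hG.commutator_eq_top,
      commutator_def, commutator_def, Subgroup.map_commutator,
      Subgroup.map_top_of_surjective φ.toMonoidHom φ.surjective]
  exists_section E _ π hπ hker := by
    obtain ⟨σ, hσ⟩ := hG.exists_section E (φ.symm.toMonoidHom.comp π)
      (φ.symm.surjective.comp hπ) (by
        intro x hx
        exact hker (by simpa [MonoidHom.mem_ker] using hx))
    refine ⟨σ.comp φ.symm.toMonoidHom, MonoidHom.ext fun x => ?_⟩
    have := congrArg φ (DFunLike.congr_fun hσ (φ.symm x))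
    simpa using this

theorem of_subsingleton [Subsingleton G] : IsSuperperfect G where
  commutator_eq_top := Subsingleton.elim _ _
  exists_section _ _ _ _ _ := ⟨1, MonoidHom.ext fun _ => Subsingleton.elim _ _⟩

/-- A partial section over the image of an injective homomorphism. -/
theorem exists_lift (hG : IsSuperperfect G) {E K : Type} [Group E] [Group K] {π : E →* K}
    (hπ : Function.Surjective π) (hker : π.ker ≤ Subgroup.center E) {ι : G →* K}
    (hι : Function.Injective ι) : ∃ σ : G →* E, π.comp σ = ι := by
  let p : ι.range.comap π →* G := (MonoidHom.ofInjective hι).symm.toMonoidHom.comp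
    ((π.domRestrict (ι.range.comap π)).codRestrict ι.range fun x => x.2)
  have hp (x : ι.range.comap π) : ι (p x) = π x :=
    congrArg Subtype.val ((MonoidHom.ofInjective hι).apply_symm_apply _)
  obtain ⟨σ, hσ⟩ := hG.exists_section _ p
    (by
      intro x
      obtain ⟨y, hy⟩ := hπ (ι x)
      exact ⟨⟨y, x, hy.symm⟩, hι ((hp _).trans hy)⟩)
    (by
      intro x hx
      have h1 : (x : E) ∈ π.ker := by
        rw [MonoidHom.mem_ker, ← hp, MonoidHom.mem_ker.1 hx, map_one]
      rw [Subgroup.mem_center_iff]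
      intro y
      exact Subtype.ext (Subgroup.mem_center_iff.1 (hker h1) y))
  refine ⟨(Subgroup.subtype _).comp σ, MonoidHom.ext fun x => ?_⟩
  have := hp (σ x)
  rw [show p (σ x) = x from DFunLike.congr_fun hσ x] at this
  exact this.symm

theorem prod (hG : IsSuperperfect G) (hH : IsSuperperfect H) : IsSuperperfect (G × H) where
  commutator_eq_top := by
    rw [commutator_def, ← Subgroup.top_prod_top, Subgroup.commutator_prod_prod,
      ← commutator_def, ← commutator_def, hG.commutator_eq_top, hH.commutator_eq_top]
  exists_section E _ π hπ hker := by
    obtain ⟨σ, hσ⟩ := hG.exists_lift hπ hker (ι := MonoidHom.inl G H)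
      fun x y h => congrArg Prod.fst h
    obtain ⟨τ, hτ⟩ := hH.exists_lift hπ hker (ι := MonoidHom.inr G H)
      fun x y h => congrArg Prod.snd h
    have hσ' (x : G) : π (σ x) = (x, 1) := DFunLike.congr_fun hσ x
    have hτ' (y : H) : π (τ y) = (1, y) := DFunLike.congr_fun hτ y
    refine ⟨σ.noncommCoprod τ fun x y =>
      commute_of_commutatorElement_mem_center hG.commutator_eq_top σ (fun x => hker ?_) x, ?_⟩
    · simp [MonoidHom.mem_ker, map_commutatorElement, hσ', hτ', commutatorElement_def]
    · ext x <;> simp [hσ', hτ']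

end IsSuperperfect

section Twisted

variable {G M : Type} [Group G] [AddCommGroup M]

/-- The underlying set of the extension defined by a cocycle. -/
@[ext] structure CocycleExt (f : G × G → M) where
  /-- The component in the kernel. -/
  fst : M
  /-- The component in the quotient. -/
  snd : G

/-- The group structure on the central extension defined by a 2-cocycle. -/
@[reducible] def CocycleExt.group {f : G × G → M}
    (hf : ∀ x y z : G, f (x * y, z) + f (x, y) = f (y, z) + f (x, y * z))
    (h1 : ∀ x, f (1, x) = f (1, 1)) : Group (CocycleExt f) :=
  letI : Mul (CocycleExt f) := ⟨fun a b => ⟨a.fst + b.fst + f (a.snd, b.snd), a.snd * b.snd⟩⟩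
  letI : One (CocycleExt f) := ⟨⟨-f (1, 1), 1⟩⟩
  letI : Inv (CocycleExt f) :=
    ⟨fun a => ⟨-a.fst - f (a.snd⁻¹, a.snd) - f (1, 1), a.snd⁻¹⟩⟩
  Group.ofLeftAxioms
    (fun a b c => CocycleExt.ext
      (by
        change a.fst + b.fst + f (a.snd, b.snd) + c.fst + f (a.snd * b.snd, c.snd) =
          a.fst + (b.fst + c.fst + f (b.snd, c.snd)) + f (a.snd, b.snd * c.snd)
        have := hf a.snd b.snd c.snd
        grind)
      (mul_assoc _ _ _))
    (fun a => CocycleExt.ext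
      (by
        change -f (1, 1) + a.fst + f (1, a.snd) = a.fst
        rw [h1 a.snd]
        abel)
      (one_mul _))
    (fun a => CocycleExt.ext
      (by
        change -a.fst - f (a.snd⁻¹, a.snd) - f (1, 1) + a.fst + f (a.snd⁻¹, a.snd) = -f (1, 1)
        abel)
      (inv_mul_cancel _))

theorem IsSuperperfect.exists_eq_coboundary (hG : IsSuperperfect G) {f : G × G → M}
    (hf : ∀ x y z : G, f (x * y, z) + f (x, y) = f (y, z) + f (x, y * z)) :
    ∃ c : G → M, ∀ x y, f (x, y) = c y - c (x * y) + c x := by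
  have h1 (x : G) : f (1, x) = f (1, 1) := by
    have := hf 1 1 x
    rw [one_mul, one_mul, add_left_cancel_iff] at this
    exact this.symm
  have h2 (x : G) : f (x, 1) = f (1, 1) := by
    have := hf x 1 1
    rw [mul_one, mul_one, add_right_cancel_iff] at this
    exact this
  letI := CocycleExt.group hf h1
  let π : CocycleExt f →* G := ⟨⟨CocycleExt.snd, rfl⟩, fun _ _ => rfl⟩
  obtain ⟨σ, hσ⟩ := hG.exists_section _ π (fun x => ⟨⟨0, x⟩, rfl⟩) (by
    rintro ⟨a, x⟩ (hx : x = 1)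
    subst hx
    rw [Subgroup.mem_center_iff]
    rintro ⟨b, y⟩
    refine CocycleExt.ext ?_ ((mul_one y).trans (one_mul y).symm)
    change b + a + f (y, 1) = a + b + f (1, y)
    rw [h1, h2, add_comm a])
  have h3 (x : G) : (σ x).snd = x := DFunLike.congr_fun hσ x
  refine ⟨fun x => -(σ x).fst, fun x y => ?_⟩
  have h4 : (σ (x * y)).fst = (σ x).fst + (σ y).fst + f ((σ x).snd, (σ y).snd) :=
    congrArg CocycleExt.fst (map_mul σ x y)
  rw [h3, h3] at h4
  simp only [h4]
  abel

theorem IsSuperperfect.subsingleton_H1 (hG : IsSuperperfect G) :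
    Subsingleton (groupCohomology (Rep.trivial ℤ G M) 1) := by
  refine subsingleton_of_forall_eq 0 fun x => ?_
  induction x using groupCohomology.H1_induction_on with | _ x
  have : x = 0 := by
    ext y
    let φ : G →* Multiplicative M :=
      ⟨⟨fun y => Multiplicative.ofAdd (x y), groupCohomology.cocycles₁_map_one x⟩,
        fun y z => groupCohomology.cocycles₁_map_mul_of_isTrivial x y z⟩
    exact IsSuperperfect.monoidHom_apply_eq_one hG.commutator_eq_top mul_comm φ y
  rw [this, map_zero]

theorem IsSuperperfect.subsingleton_H2 (hG : IsSuperperfect G) :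
    Subsingleton (groupCohomology (Rep.trivial ℤ G M) 2) := by
  refine subsingleton_of_forall_eq 0 fun x => ?_
  induction x using groupCohomology.H2_induction_on with | _ x
  obtain ⟨c, hc⟩ := hG.exists_eq_coboundary (f := (x : G × G → M))
    fun y z w => (groupCohomology.mem_cocycles₂_iff _).1 x.2 y z w
  rw [groupCohomology.H2π_eq_zero_iff]
  exact ⟨c, funext fun y => (hc y.1 y.2).symm⟩

end Twisted

namespace ZMod

variable {p k : ℕ}

theorem isUnit_natCast_prime_pow (hp : p.Prime) (hk : k ≠ 0) (n : ℕ) :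
    IsUnit (n : ZMod (p ^ k)) ↔ ¬ p ∣ n := by
  rw [ZMod.isUnit_iff_coprime, Nat.coprime_pow_right_iff (Nat.pos_of_ne_zero hk), Nat.coprime_comm,
    hp.coprime_iff_not_dvd]

theorem isSquare_of_dvd_sub_one (hp : p.Prime) (hp2 : p ≠ 2) (hk : k ≠ 0) {u : (ZMod (p ^ k))ˣ}
    {n : ℕ} (hu : (u : ZMod (p ^ k)) = n) (hn : (p : ℤ) ∣ n - 1) : IsSquare u := by
  obtain ⟨k, rfl⟩ := Nat.exists_eq_succ_of_ne_zero hk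
  have h1 : ((p ^ (k + 1) : ℕ) : ℤ) ∣ (n : ℤ) ^ p ^ k - 1 ^ p ^ k := by
    have := dvd_sub_pow_of_dvd_sub hn k
    exact_mod_cast this
  have h2 : u ^ p ^ k = 1 := by
    ext
    rw [Units.val_pow_eq_pow_val, hu, Units.val_one, ← sub_eq_zero]
    rw [← ZMod.intCast_zmod_eq_zero_iff_dvd] at h1
    simpa using h1
  obtain ⟨t, ht⟩ := (hp.odd_of_ne_two hp2).pow (n := k)
  refine ⟨u ^ (t + 1), ?_⟩
  calc u = u * u ^ p ^ k := by rw [h2, mul_one]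
    _ = u ^ (t + 1) * u ^ (t + 1) := by rw [ht, ← pow_succ', ← pow_add]; congr 1; ring

theorem isOddResidueRing_prime_pow (hp : p.Prime) (hp2 : p ≠ 2) (hk : k ≠ 0) :
    IsOddResidueRing (ZMod (p ^ k)) := by
  have hq : 2 < p ^ k := lt_of_lt_of_le (lt_of_le_of_ne hp.two_le hp2.symm)
    (Nat.le_self_pow hk p)
  have : Fact (1 < p ^ k) := ⟨by omega⟩
  have : NeZero (p ^ k) := ⟨by omega⟩
  have hloc : IsLocalRing (ZMod (p ^ k)) := by
    refine IsLocalRing.of_nonunits_add fun a b ha hb => ?_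
    obtain ⟨a, rfl⟩ := ZMod.natCast_zmod_surjective a
    obtain ⟨b, rfl⟩ := ZMod.natCast_zmod_surjective b
    rw [mem_nonunits_iff, isUnit_natCast_prime_pow hp hk, not_not] at ha hb
    rw [mem_nonunits_iff, ← Nat.cast_add, isUnit_natCast_prime_pow hp hk, not_not]
    exact dvd_add ha hb
  have two : IsUnit (2 : ZMod (p ^ k)) := by
    have := (isUnit_natCast_prime_pow hp hk 2).2
      fun h => hp2 ((Nat.prime_dvd_prime_iff_eq hp Nat.prime_two).1 h)
    exact_mod_cast this
  have hsq : ∃ n : ℕ, ∃ u : (ZMod (p ^ k))ˣ, (u : ZMod (p ^ k)) = n ∧ ¬ IsSquare u := by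
    by_contra! h
    have h1 : Function.Surjective fun u : (ZMod (p ^ k))ˣ => u * u := by
      intro u
      obtain ⟨n, hn⟩ := ZMod.natCast_zmod_surjective (u : ZMod (p ^ k))
      obtain ⟨r, hr⟩ := h n u hn.symm
      exact ⟨r, hr.symm⟩
    have h2 := congrArg Units.val (Finite.injective_iff_surjective.2 h1
      (a₁ := -1) (a₂ := 1) (by simp))
    have h3 : (2 : ZMod (p ^ k)) = 0 := by
      rw [Units.val_neg, Units.val_one] at h2
      linear_combination -h2
    rw [h3] at two
    exact not_isUnit_zero two
  exact
    { hloc with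
      isUnit_two := two
      exists_intCast_eq := ZMod.intCast_surjective
      isCyclic_units := isCyclic_units_of_prime_pow p hp hp2 k
      dvd_total := by
        intro a b
        obtain ⟨a, rfl⟩ := ZMod.natCast_zmod_surjective a
        obtain ⟨b, rfl⟩ := ZMod.natCast_zmod_surjective b
        rcases eq_or_ne a 0 with rfl | ha
        · simp
        rcases eq_or_ne b 0 with rfl | hb
        · simp
        obtain ⟨i, a', ha', rfl⟩ := Nat.exists_eq_pow_mul_and_not_dvd ha p hp.ne_one
        obtain ⟨j, b', hb', rfl⟩ := Nat.exists_eq_pow_mul_and_not_dvd hb p hp.ne_one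
        rw [← isUnit_natCast_prime_pow hp hk] at ha' hb'
        push_cast
        rw [ha'.mul_right_dvd, hb'.mul_right_dvd, hb'.dvd_mul_right, ha'.dvd_mul_right]
        exact (le_total i j).imp (pow_dvd_pow _) (pow_dvd_pow _)
      exists_nonsquare := by
        classical
        obtain ⟨u, hu, hu'⟩ := Nat.find_spec hsq
        have hmin := fun m => Nat.find_min (m := m) hsq
        generalize Nat.find hsq = n at hu hmin
        obtain ⟨m, rfl⟩ : ∃ m, n = m + 1 := by
          refine Nat.exists_eq_succ_of_ne_zero ?_
          rintro rfl
          exact u.ne_zero (by simpa using hu)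
        have hm : IsUnit (m : ZMod (p ^ k)) := by
          rw [isUnit_natCast_prime_pow hp hk]
          intro h
          exact hu' (isSquare_of_dvd_sub_one hp hp2 hk hu (by
            simpa using Int.natCast_dvd_natCast.2 h))
        obtain ⟨w, hw⟩ := hm
        have hw' : IsSquare w := by
          by_contra h
          exact hmin m (Nat.lt_succ_self m) ⟨w, hw, h⟩
        refine ⟨u⁻¹, w * u⁻¹, ?_, ?_, ?_⟩
        · rwa [isSquare_inv]
        · intro h
          apply hu'
          have := hw'.div h
          rwa [div_mul_eq_div_div, div_self', one_div, inv_inv] at this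
        · rw [Units.val_mul, hw, ← one_add_mul, Units.mul_inv_eq_iff_eq_mul, hu]
          push_cast
          ring }

end ZMod

namespace Symp

section Matrix

variable (g : ℕ) (R : Type) [CommRing R]

/-- The standard alternating form. -/
def stdForm : (Fin g ⊕ Fin g → R) →ₗ[R] (Fin g ⊕ Fin g → R) →ₗ[R] R :=
  Matrix.toLinearMap₂' R (Matrix.J (Fin g) R)

theorem stdForm_apply (x y : Fin g ⊕ Fin g → R) :
    stdForm g R x y = ∑ i, (x (.inr i) * y (.inl i) - x (.inl i) * y (.inr i)) := by
  rw [stdForm, Matrix.toLinearMap₂'_apply', dotProduct, Fintype.sum_sum_type]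
  simp only [Matrix.J, Matrix.fromBlocks_mulVec]
  simp [Finset.sum_sub_distrib, Matrix.neg_mulVec, neg_add_eq_sub]

instance : Fact (stdForm g R).IsAlt := ⟨fun x => by simp [stdForm_apply, mul_comm]⟩

theorem isSympBasis_stdForm : IsSympBasis (stdForm g R) g
    (fun i => if h : i < g then Pi.single (.inr ⟨i, h⟩) 1 else 0)
    (fun i => if h : i < g then Pi.single (.inl ⟨i, h⟩) 1 else 0) where
  form_ef {i} hi := by simp [stdForm_apply, hi, Pi.single_apply]
  form_ef_ne {i j} hi hj hij := by
    simp [stdForm_apply, hi, hj, Pi.single_apply, hij, hij.symm]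
  form_ee {i j} hi hj := by simp [stdForm_apply, hi, hj, Pi.single_apply]
  form_ff {i j} hi hj := by simp [stdForm_apply, hi, hj, Pi.single_apply]
  eq_sum x := by
    rw [Finset.sum_range]
    ext (i | i) <;> simp [stdForm_apply, Pi.single_apply]

variable {g R} in
theorem stdForm_mulVec (M : Matrix (Fin g ⊕ Fin g) (Fin g ⊕ Fin g) R)
    (x y : Fin g ⊕ Fin g → R) :
    stdForm g R (M.mulVec x) (M.mulVec y) =
      Matrix.toLinearMap₂' R (M.transpose * Matrix.J (Fin g) R * M) x y := by
  rw [stdForm, Matrix.toLinearMap₂'_apply', Matrix.toLinearMap₂'_apply', Matrix.mul_assoc,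
    ← Matrix.mulVec_mulVec, ← Matrix.mulVec_mulVec, Matrix.dotProduct_mulVec x,
    Matrix.vecMul_transpose]

variable {g R} in
theorem mem_symplecticGroup_iff_stdForm {M : Matrix (Fin g ⊕ Fin g) (Fin g ⊕ Fin g) R} :
    M ∈ Matrix.symplecticGroup (Fin g) R ↔
      ∀ x y, stdForm g R (M.mulVec x) (M.mulVec y) = stdForm g R x y := by
  rw [SymplecticGroup.mem_iff']
  simp only [stdForm_mulVec]
  rw [stdForm, ← LinearMap.ext_iff₂, EmbeddingLike.apply_eq_iff_eq]

/-- The symplectic group as a group of isometries. -/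
noncomputable def symplecticGroupEquiv : Sp (stdForm g R) ≃* Matrix.symplecticGroup (Fin g) R where
  toFun M := ⟨LinearMap.toMatrix' M.1.toLinearMap, by
    rw [mem_symplecticGroup_iff_stdForm]
    intro x y
    rw [LinearMap.toMatrix'_mulVec, LinearMap.toMatrix'_mulVec]
    exact M.2 x y⟩
  invFun A := ⟨Matrix.toLin'OfInv (M := (A⁻¹).1) (M' := A.1)
      (congrArg Subtype.val (inv_mul_cancel A)) (congrArg Subtype.val (mul_inv_cancel A)),
    mem_symplecticGroup_iff_stdForm.1 A.2⟩
  left_inv M := by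
    refine Sp.ext fun x => ?_
    exact LinearMap.toMatrix'_mulVec M.1.toLinearMap x
  right_inv A := by
    ext1
    exact LinearMap.toMatrix'_toLin' _
  map_mul' M M' := by
    ext1
    exact LinearMap.toMatrix'_comp _ _

theorem isSuperperfect_symplecticGroup [IsOddResidueRing R] (hg : 2 ≤ g) :
    IsSuperperfect (Matrix.symplecticGroup (Fin g) R) := by
  refine IsSuperperfect.of_mulEquiv ⟨(isSympBasis_stdForm g R).commutator_eq_top hg,
    fun E _ π hπ hker => ?_⟩ (symplecticGroupEquiv g R)
  exact CentralExt.exists_section (g := g) ⟨_, _, hker, hπ, isSympBasis_stdForm g R, hg⟩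

end Matrix

section Product

variable {l R S T : Type} [DecidableEq l] [Fintype l] [CommRing R] [CommRing S] [CommRing T]

/-- The homomorphism of symplectic groups induced by a ring homomorphism. -/
def symplecticGroupMap (φ : R →+* S) :
    Matrix.symplecticGroup l R →* Matrix.symplecticGroup l S where
  toFun A := ⟨A.1.map φ, SymplecticGroup.map_mem A.2 φ⟩
  map_one' := by ext1; exact Matrix.map_one φ (map_zero _) (map_one _)
  map_mul' A B := by ext1; exact Matrix.map_mul

theorem bijective_symplecticGroupMap_prod (φ : R ≃+* S × T) :
    Function.Bijective ((symplecticGroupMap (l := l) ((RingHom.fst S T).comp (φ : R →+* S × T))).prod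
      (symplecticGroupMap ((RingHom.snd S T).comp (φ : R →+* S × T)))) := by
  have key (A B : Matrix (l ⊕ l) (l ⊕ l) R)
      (h1 : A.map ((RingHom.fst S T).comp (φ : R →+* S × T)) =
        B.map ((RingHom.fst S T).comp (φ : R →+* S × T)))
      (h2 : A.map ((RingHom.snd S T).comp (φ : R →+* S × T)) =
        B.map ((RingHom.snd S T).comp (φ : R →+* S × T))) : A = B := by
    ext i j
    exact φ.injective (Prod.ext (congrFun₂ h1 i j) (congrFun₂ h2 i j))
  constructor
  · intro A B h
    exact Subtype.ext (key _ _ (congrArg (fun x => x.1.1) h) (congrArg (fun x => x.2.1) h))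
  · rintro ⟨⟨A, hA⟩, ⟨B, hB⟩⟩
    set C : Matrix (l ⊕ l) (l ⊕ l) R := Matrix.of fun i j => φ.symm (A i j, B i j) with hC
    have h1 : C.map ((RingHom.fst S T).comp (φ : R →+* S × T)) = A := by ext; simp [hC]
    have h2 : C.map ((RingHom.snd S T).comp (φ : R →+* S × T)) = B := by ext; simp [hC]
    refine ⟨⟨C, ?_⟩, Prod.ext (Subtype.ext h1) (Subtype.ext h2)⟩
    rw [SymplecticGroup.mem_iff] at hA hB ⊢
    apply key
    · rw [Matrix.map_mul, Matrix.map_mul, Matrix.transpose_map, h1, Matrix.map_J, hA]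
    · rw [Matrix.map_mul, Matrix.map_mul, Matrix.transpose_map, h2, Matrix.map_J, hB]

end Product

end Symp

theorem isSuperperfect_symplecticGroup_zmod {g N : ℕ} (hg : 2 ≤ g) (hN : Odd N) :
    IsSuperperfect (Matrix.symplecticGroup (Fin g) (ZMod N)) := by
  induction N using Nat.recOnPosPrimePosCoprime with
  | prime_pow p n hp hn =>
    have := ZMod.isOddResidueRing_prime_pow (k := n) hp
      (by
        rintro rfl
        rw [Nat.odd_pow_iff hn.ne'] at hN
        exact absurd hN (by decide)) hn.ne'
    exact Symp.isSuperperfect_symplecticGroup g _ hg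
  | zero => exact absurd hN (by decide)
  | one =>
    have : Subsingleton (ZMod 1) := inferInstanceAs (Subsingleton (Fin 1))
    exact IsSuperperfect.of_subsingleton
  | coprime a b _ _ hab iha ihb =>
    rw [Nat.odd_mul] at hN
    exact ((iha hN.1).prod (ihb hN.2)).of_mulEquiv (MulEquiv.ofBijective _
      (Symp.bijective_symplecticGroupMap_prod (ZMod.chineseRemainder hab))).symm

/-- For every `g ≥ 3`, every odd `N ≥ 1` and `i ∈ {1, 2}`, the group
cohomology `Hⁱ(Sp_{2g}(ℤ/Nℤ), ℂ*)` vanishes, where `ℂ*` is the multiplicative group of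
nonzero complex numbers with the trivial action. -/
theorem h1_h2_symplecticGroup_units_complex_vanish (g N : ℕ) (hg : 3 ≤ g) (hN : 1 ≤ N)
    (hNodd : Odd N) (i : ℕ) (hi : i = 1 ∨ i = 2) :
    Subsingleton
      (groupCohomology
        (Rep.trivial ℤ ↥(Matrix.symplecticGroup (Fin g) (ZMod N)) (Additive ℂˣ)) i) := by
  have hG := isSuperperfect_symplecticGroup_zmod (g := g) (by omega) hNodd
  rcases hi with rfl | rfl
  · exact hG.subsingleton_H1
  · exact hG.subsingleton_H2
end

section
/- Let p ≥ 5 be a prime and let T and S be symmetric 2×2 matrices over 𝔽_p with det(T) ≠ 0. Suppose that for every vector v ∈ 𝔽_p², if ᵀv·T·v ≠ 0 then ᵀv·S·v = 0. Then S = 0. -/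
open Matrix

open Polynomial in
/-- Over a field with more than four elements, if the product of two quadratic polynomial functions
vanishes identically, then one of the quadratics is zero. -/
theorem quadratic_eq_zero_or_of_forall_eval {K : Type*} [Field K] [Fintype K]
    (hK : 4 < Fintype.card K) {a b c d e f : K}
    (h : ∀ x : K, (a * x ^ 2 + b * x + c) * (d * x ^ 2 + e * x + f) = 0) :
    (a = 0 ∧ b = 0 ∧ c = 0) ∨ (d = 0 ∧ e = 0 ∧ f = 0) := by
  have coeffs_eq_zero : ∀ {r s t : K}, C r * X ^ 2 + C s * X + C t = 0 →
      r = 0 ∧ s = 0 ∧ t = 0 := fun {r s t} hq =>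
    ⟨by simpa [coeff_X, coeff_C] using congrArg (coeff · 2) hq,
      by simpa [coeff_X, coeff_C] using congrArg (coeff · 1) hq,
      by simpa [coeff_X, coeff_C] using congrArg (coeff · 0) hq⟩
  have hprod : (C a * X ^ 2 + C b * X + C c) * (C d * X ^ 2 + C e * X + C f) = 0 := by
    refine eq_zero_of_natDegree_lt_card_of_eval_eq_zero _ Function.injective_id
      (fun x => by simpa using h x) (lt_of_le_of_lt ?_ hK)
    exact natDegree_mul_le.trans (add_le_add natDegree_quadratic_le natDegree_quadratic_le)
  exact (mul_eq_zero.mp hprod).imp coeffs_eq_zero coeffs_eq_zero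

/-- Let `p ≥ 5` be a prime and `T`, `S` symmetric `2×2` matrices over
`𝔽_p` with `det T ≠ 0`.  If for every vector `v ∈ 𝔽_p²` with `ᵀv·T·v ≠ 0` one has
`ᵀv·S·v = 0`, then `S = 0`. -/
theorem symm_matrix_vanishing_on_nonisotropic (p : ℕ) (hp : p.Prime) (hp5 : 5 ≤ p)
    (T S : Matrix (Fin 2) (Fin 2) (ZMod p)) (hT : Tᵀ = T) (hS : Sᵀ = S)
    (hdet : T.det ≠ 0)
    (h : ∀ v : Fin 2 → ZMod p, v ⬝ᵥ T.mulVec v ≠ 0 → v ⬝ᵥ S.mulVec v = 0) :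
    S = 0 := by
  have : Fact p.Prime := ⟨hp⟩
  have h2 : (2 : ZMod p) ≠ 0 := fun h0 => by
    have := Nat.le_of_dvd two_pos ((ZMod.natCast_eq_zero_iff 2 p).mp (by exact_mod_cast h0))
    omega
  have hT10 : T 1 0 = T 0 1 := congrFun₂ hT 0 1
  have hS10 : S 1 0 = S 0 1 := congrFun₂ hS 0 1
  have form_eq : ∀ M : Matrix (Fin 2) (Fin 2) (ZMod p), M 1 0 = M 0 1 → ∀ x : ZMod p,
      ![x, 1] ⬝ᵥ M.mulVec ![x, 1] = M 0 0 * x ^ 2 + 2 * M 0 1 * x + M 1 1 := by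
    intro M hM x
    simp [dotProduct, mulVec, Fin.sum_univ_two, hM]
    ring
  have hprod : ∀ x : ZMod p, (T 0 0 * x ^ 2 + 2 * T 0 1 * x + T 1 1) *
      (S 0 0 * x ^ 2 + 2 * S 0 1 * x + S 1 1) = 0 := by
    intro x
    rw [← form_eq T hT10, ← form_eq S hS10, mul_eq_zero]
    exact or_iff_not_imp_left.mpr (h _)
  rcases quadratic_eq_zero_or_of_forall_eval (by rw [ZMod.card]; omega) hprod with
    ⟨h00, h01, -⟩ | ⟨h00, h01, h11⟩
  · have hT01 : T 0 1 = 0 := (mul_eq_zero.mp h01).resolve_left h2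
    exact absurd (by simp [det_fin_two, h00, hT01]) hdet
  · have hS01 : S 0 1 = 0 := (mul_eq_zero.mp h01).resolve_left h2
    ext i j
    fin_cases i <;> fin_cases j <;> simp [h00, hS01, h11, hS10]
end
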